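/- arXiv:2003.12429 — 4 statements merged into one kernel-verified Lean document; each statement's English description precedes it below -/
import Mathlib

section
/- Let q be a prime power, F a finite field with q elements, and n ≥ 3. If 𝓛 is a Cameron–Liebler (n−2)-set of AG(n,q) with |𝓛| = x·[n n−2]_q for a natural number x, then 2(q+1) divides x(x−1), i.e. x(x−1)/2 ≡ 0 (mod q+1). -/
open Module

/-- The Gaussian binomial coefficient `[a b]_q`. -/
noncomputable def gaussBinom (q a b : ℕ) : ℚ :=
  ∏ i ∈ Finset.range b, ((q : ℚ) ^ (a - i) - 1) / ((q : ℚ) ^ (i + 1) - 1)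

variable {F : Type} [Field F] [Fintype F] {n : ℕ}

/-- `K` is a projective `j`-space of `PG(n,q)`: a submodule of rank `j+1`. -/
def IsProjSub (j : ℕ) (K : Submodule F (Fin (n + 1) → F)) : Prop :=
  Module.finrank F K = j + 1

/-- `P` is a projective point: a submodule of rank `1`. -/
def IsProjPoint (P : Submodule F (Fin (n + 1) → F)) : Prop :=
  Module.finrank F P = 1

/-- `P` is an affine point w.r.t. the hyperplane at infinity `Hinf`. -/
def IsAffPoint (Hinf P : Submodule F (Fin (n + 1) → F)) : Prop :=
  Module.finrank F P = 1 ∧ ¬ P ≤ Hinf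

/-- `K` is an affine `j`-space (a `j`-space of `AG(n,q)`). -/
def IsAffSub (j : ℕ) (Hinf K : Submodule F (Fin (n + 1) → F)) : Prop :=
  Module.finrank F K = j + 1 ∧ ¬ K ≤ Hinf

/-- `M` is a Cameron–Liebler `k`-set of `PG(n,q)`. -/
def IsCLProj (k : ℕ) (M : Set (Submodule F (Fin (n + 1) → F))) : Prop :=
  (∀ K ∈ M, IsProjSub k K) ∧
  ∃ w : Submodule F (Fin (n + 1) → F) → ℝ,
    ∀ K, IsProjSub k K →
      Set.indicator M (fun _ => (1 : ℝ)) K =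
        ∑ᶠ P ∈ {P | IsProjPoint P ∧ P ≤ K}, w P

/-- `L` is a Cameron–Liebler `k`-set of `AG(n,q)`. -/
def IsCLAff (k : ℕ) (Hinf : Submodule F (Fin (n + 1) → F))
    (L : Set (Submodule F (Fin (n + 1) → F))) : Prop :=
  (∀ K ∈ L, IsAffSub k Hinf K) ∧
  ∃ w : Submodule F (Fin (n + 1) → F) → ℝ,
    ∀ K, IsAffSub k Hinf K →
      Set.indicator L (fun _ => (1 : ℝ)) K =
        ∑ᶠ P ∈ {P | IsAffPoint Hinf P ∧ P ≤ K}, w P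

/-- `S` is a `k`-spread of `AG(n,q)`: every affine point is on exactly one member. -/
def IsSpread (k : ℕ) (Hinf : Submodule F (Fin (n + 1) → F))
    (S : Set (Submodule F (Fin (n + 1) → F))) : Prop :=
  (∀ K ∈ S, IsAffSub k Hinf K) ∧
  ∀ P, IsAffPoint Hinf P → ∃! K, K ∈ S ∧ P ≤ K


section
variable {F : Type*} [Field F]

/-- Linear coordinates in which a given hyperplane is the kernel of the first one. -/
theorem exists_coordinates {V : Type*} [AddCommGroup V] [Module F V] [FiniteDimensional F V]
    {n k : ℕ} (hk : k ≤ n) (H : Submodule F V) (hH : finrank F H = n)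
    (hV : finrank F V = n + 1) :
    ∃ (φ : V →ₗ[F] F) (g : V →ₗ[F] (Fin k → F)), (∀ v, φ v = 0 ↔ v ∈ H) ∧
      Function.Surjective (φ.prod g) := by
  obtain ⟨H', hc⟩ := H.exists_isCompl
  have hH' : finrank F H' = 1 := by
    have := Submodule.finrank_add_eq_of_isCompl hc
    omega
  let e := (H.prodEquivOfIsCompl H' hc).symm
  let e₁ : H ≃ₗ[F] (Fin n → F) := LinearEquiv.ofFinrankEq _ _ (by simp [hH])
  let e₂ : H' ≃ₗ[F] F := LinearEquiv.ofFinrankEq _ _ (by simp [hH'])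
  refine ⟨e₂.toLinearMap ∘ₗ LinearMap.snd F H H' ∘ₗ e.toLinearMap,
    LinearMap.funLeft F F (Fin.castLE hk) ∘ₗ e₁.toLinearMap ∘ₗ LinearMap.fst F H H' ∘ₗ
      e.toLinearMap, ?_, ?_⟩
  · intro v
    simp [e]
  · rintro ⟨c, y⟩
    obtain ⟨z, hz⟩ := LinearMap.funLeft_surjective_of_injective F F _ (Fin.castLE_injective hk) y
    exact ⟨e.symm (e₁.symm z, e₂.symm c), by simp [hz]⟩

/-- The preimage under a surjection to `F × E` of the affine line `y + ⟨d⟩` has codimension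
`dim E - 1`. -/
theorem finrank_comap_span_pair {V E : Type*} [AddCommGroup V] [Module F V]
    [FiniteDimensional F V] [AddCommGroup E] [Module F E] [FiniteDimensional F E]
    (p : V →ₗ[F] F × E) (hp : Function.Surjective p) (y : E) {d : E} (hd : d ≠ 0) :
    finrank F ((Submodule.span F {((1 : F), y), ((0 : F), d)}).comap p) + finrank F E =
      finrank F V + 1 := by
  set A := Submodule.span F {((1 : F), y), ((0 : F), d)} with hA
  have h1 : finrank F A = 2 := by
    have hl : LinearIndependent F ![((1 : F), y), ((0 : F), d)] := by
      rw [LinearIndependent.pair_iff]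
      intro s t h
      simp only [Prod.smul_mk, Prod.mk_add_mk, Prod.mk_eq_zero, smul_eq_mul] at h
      have hs : s = 0 := by simpa using h.1
      simpa [hs, hd] using h.2
    have := finrank_span_eq_card hl
    rwa [Matrix.range_cons_cons_empty, Fintype.card_fin, ← hA] at this
  have h2 := A.finrank_quotient_add_finrank
  have h3 := (A.mkQ ∘ₗ p).finrank_range_add_finrank_ker
  rw [LinearMap.ker_comp, Submodule.ker_mkQ,
    LinearMap.range_eq_top.2 (by simpa using A.mkQ_surjective.comp hp), finrank_top] at h3
  rw [finrank_prod, finrank_self] at h2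
  omega

theorem mem_span_pair_iff {E : Type*} [AddCommGroup E] [Module F E] (y z d : E) :
    ((1 : F), z) ∈ Submodule.span F {((1 : F), y), ((0 : F), d)} ↔ ∃ t : F, z = y + t • d := by
  rw [Submodule.mem_span_pair]
  constructor
  · rintro ⟨a, b, h⟩
    simp only [Prod.smul_mk, Prod.mk_add_mk, Prod.mk.injEq, smul_eq_mul] at h
    have ha : a = 1 := by simpa using h.1
    exact ⟨b, by rw [← h.2, ha, one_smul]⟩
  · rintro ⟨t, rfl⟩
    exact ⟨1, t, by simp⟩

end

section
variable {F : Type*} [Field F] [Fintype F]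

/-- Summing along parallel lines over a transversal hyperplane recovers the sum over any set of
points that is a union of such lines. -/
theorem sum_eq_sum_lines [DecidableEq F] {E : Type*} [AddCommGroup E] [Module F E] [Fintype E]
    (u : E → ℝ) (A : E → Prop) [DecidablePred A] {d : E} (hA : ∀ y (t : F), A (y + t • d) ↔ A y)
    (ψ : E →ₗ[F] F) (hψ : ψ d = 1) :
    ∑ y with A y, u y = ∑ y with A y ∧ ψ y = 0, ∑ t : F, u (y + t • d) := by
  rw [Finset.sum_sigma']
  symm
  refine Finset.sum_bij' (fun p _ => p.1 + p.2 • d) (fun y _ => ⟨y - ψ y • d, ψ y⟩) ?_ ?_ ?_ ?_ ?_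
  · rintro ⟨y, t⟩ h
    simp at h ⊢
    exact (hA _ _).2 h.1
  · intro y h
    simp at h ⊢
    refine ⟨?_, by simp [hψ]⟩
    rw [sub_eq_add_neg, ← neg_smul]
    exact (hA _ _).2 h
  · rintro ⟨y, t⟩ h
    simp at h
    simp [hψ, h.2]
  · intro y h
    simp
  · rintro ⟨y, t⟩ h
    rfl

theorem exists_intCast_of_line_sums [DecidableEq F] (u : (Fin 3 → F) → ℝ)
    (hu : ∀ y d, d ≠ 0 → ∑ t : F, u (y + t • d) = 0 ∨ ∑ t : F, u (y + t • d) = 1)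
    (v : Fin 3 → F) (c : F) : ∃ m : ℤ, ∑ y with v ⬝ᵥ y = c, u y = m := by
  obtain ⟨d, hd, hvd⟩ : ∃ d : Fin 3 → F, d ≠ 0 ∧ v ⬝ᵥ d = 0 := by
    by_cases h : v 0 = 0
    · exact ⟨Pi.single 0 1, by simp, by simp [h]⟩
    · refine ⟨![- v 1, v 0, 0], fun hh => h (by simpa using congrFun hh 1), ?_⟩
      simp [dotProduct, Fin.sum_univ_three]; ring
  obtain ⟨i, hi⟩ := Function.ne_iff.1 hd
  simp at hi
  rw [sum_eq_sum_lines u (fun y => v ⬝ᵥ y = c) (d := d) (by simp [hvd])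
    ((d i)⁻¹ • LinearMap.proj i) (by simp [hi])]
  choose! f hf using fun y => show ∃ m : ℤ, ∑ t : F, u (y + t • d) = m from
    (hu y d hd).elim (fun h => ⟨0, by simpa using h⟩) (fun h => ⟨1, by simpa using h⟩)
  exact ⟨_, by rw [Int.cast_sum]; exact Finset.sum_congr rfl fun y _ => hf y⟩

theorem card_dotProduct_eq_zero [DecidableEq F] {w : Fin 3 → F} (hw : w ≠ 0) :
    (Finset.univ.filter fun v : Fin 3 → F => v ⬝ᵥ w = 0).card = Fintype.card F ^ 2 := by
  let φ : (Fin 3 → F) →ₗ[F] F := (dotProductBilin F F).flip w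
  have hφ : ∀ v, φ v = v ⬝ᵥ w := fun v => rfl
  have hs : Function.Surjective φ := by
    apply LinearMap.surjective
    rintro h
    obtain ⟨i, hi⟩ := Function.ne_iff.1 hw
    apply hi
    simpa [hφ] using LinearMap.congr_fun h (Pi.single i 1)
  have h1 := φ.finrank_range_add_finrank_ker
  rw [LinearMap.range_eq_top.2 hs] at h1
  simp at h1
  have h2 : finrank F (LinearMap.ker φ) = 2 := by omega
  rw [← h2, ← Nat.card_eq_fintype_card, ← Module.natCard_eq_pow_finrank (K := F),
    Nat.card_congr (Equiv.subtypeEquivRight fun v => by rw [LinearMap.mem_ker, hφ]),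
    Nat.card_eq_fintype_card, Fintype.card_subtype]

/-- Second moment of a weight along the lines of `F³`, when all line sums are `0` or `1`. -/
theorem sum_sq_of_line_sums (u : (Fin 3 → F) → ℝ)
    (hu : ∀ y d, d ≠ 0 → ∑ t : F, u (y + t • d) = 0 ∨ ∑ t : F, u (y + t • d) = 1) :
    ((Fintype.card F : ℝ) ^ 3 - 1) * ∑ y, u y =
      ((Fintype.card F : ℝ) ^ 3 - Fintype.card F) * ∑ y, u y ^ 2 +
        (Fintype.card F - 1) * (∑ y, u y) ^ 2 := by
  classical
  set q : ℝ := (Fintype.card F : ℝ) with hq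
  have hq0 : q ≠ 0 := by simp [q]
  set X := ∑ y, u y with hX
  have shift : ∀ (g : (Fin 3 → F) → ℝ) (e : Fin 3 → F), ∑ y, g (y + e) = ∑ y, g y := fun g e =>
    Equiv.sum_comp (Equiv.addRight e) g
  have dir : ∀ d : Fin 3 → F, d ≠ 0 → ∑ y, u y * ∑ t : F, u (y + t • d) = X := by
    intro d hd
    have h1 : ∑ y, (∑ t : F, u (y + t • d)) ^ 2 = ∑ y, ∑ t : F, u (y + t • d) :=
      Finset.sum_congr rfl fun y _ => by rcases hu y d hd with h | h <;> simp [h]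
    have h2 : ∑ y, ∑ t : F, u (y + t • d) = q * X := by
      rw [Finset.sum_comm, Finset.sum_congr rfl fun t _ => shift u (t • d)]
      simp [q, X]
    have h3 : ∑ y, (∑ t : F, u (y + t • d)) ^ 2 = q * ∑ y, u y * ∑ t : F, u (y + t • d) := by
      have : ∀ y (s : F), ∑ t : F, u (y + t • d) = ∑ t : F, u (y + s • d + t • d) := by
        intro y s
        rw [← Equiv.sum_comp (Equiv.addLeft s) fun t => u (y + t • d)]
        simp [add_smul, add_assoc]
      calc ∑ y, (∑ t : F, u (y + t • d)) ^ 2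
          = ∑ y, ∑ s : F, u (y + s • d) * ∑ t : F, u (y + s • d + t • d) := by
            refine Finset.sum_congr rfl fun y _ => ?_
            rw [sq, Finset.sum_mul]
            exact Finset.sum_congr rfl fun s _ => by rw [← this]
        _ = _ := by
            rw [Finset.sum_comm, Finset.sum_congr rfl fun s _ =>
              shift (fun y => u y * ∑ t : F, u (y + t • d)) (s • d)]
            simp [q]
    exact mul_left_cancel₀ hq0 (by rw [← h3, h1, h2])
  have all : ∀ y, ∑ d : Fin 3 → F, ∑ t : F, u (y + t • d) = q ^ 3 * u y + (q - 1) * X := by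
    intro y
    rw [Finset.sum_comm, ← Finset.add_sum_erase _ _ (Finset.mem_univ (0 : F))]
    have : ∀ t ∈ Finset.univ.erase (0 : F), ∑ d : Fin 3 → F, u (y + t • d) = X := by
      intro t ht
      have ht : t ≠ 0 := by simpa using ht
      rw [hX, ← Equiv.sum_comp ((Equiv.smulRight ht).trans (Equiv.addLeft y)) u]
      rfl
    rw [Finset.sum_congr rfl this]
    have h1 : 1 ≤ Fintype.card F := Fintype.card_pos
    simp [q, Nat.cast_sub h1, Finset.card_erase_of_mem]
  have key : ∑ y, u y * ∑ d : Fin 3 → F, ∑ t : F, u (y + t • d) =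
      (q ^ 3 - 1) * X + q * ∑ y, u y ^ 2 := by
    simp_rw [Finset.mul_sum (s := (Finset.univ : Finset (Fin 3 → F)))]
    rw [Finset.sum_comm, ← Finset.add_sum_erase _ _ (Finset.mem_univ (0 : Fin 3 → F)),
      Finset.sum_congr rfl fun d hd => dir d (by simpa using hd)]
    have h1 : 1 ≤ Fintype.card F ^ 3 := Nat.one_le_pow _ _ Fintype.card_pos
    simp [q, Nat.cast_sub h1, Finset.card_erase_of_mem]
    rw [add_comm]
    congr 1
    exact Finset.sum_congr rfl fun y _ => by ring
  have key2 : ∑ y, u y * ∑ d : Fin 3 → F, ∑ t : F, u (y + t • d) =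
      q ^ 3 * ∑ y, u y ^ 2 + (q - 1) * X ^ 2 := by
    simp_rw [all, mul_add, Finset.sum_add_distrib]
    rw [← Finset.sum_mul, ← hX]
    congr 1
    · rw [Finset.mul_sum]
      exact Finset.sum_congr rfl fun y _ => by ring
    · ring
  linarith

/-- Second moment of the plane sums of a weight on `F³`. -/
theorem sum_plane_sums_sq [DecidableEq F] (u : (Fin 3 → F) → ℝ) :
    ∑ v : Fin 3 → F, ∑ c : F, (∑ y with v ⬝ᵥ y = c, u y) ^ 2 =
      ((Fintype.card F : ℝ) ^ 3 - Fintype.card F ^ 2) * ∑ y, u y ^ 2 +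
        Fintype.card F ^ 2 * (∑ y, u y) ^ 2 := by
  have h1 : ∀ v : Fin 3 → F, ∑ c : F, (∑ y with v ⬝ᵥ y = c, u y) ^ 2 =
      ∑ y, ∑ z, if v ⬝ᵥ (z - y) = 0 then u y * u z else 0 := by
    intro v
    simp_rw [sq, Finset.sum_mul_sum, Finset.sum_filter]
    rw [Finset.sum_comm]
    refine Finset.sum_congr rfl fun y _ => ?_
    simp [dotProduct_sub, sub_eq_zero]
  simp_rw [h1]
  rw [Finset.sum_comm, Finset.sum_congr rfl fun y _ => Finset.sum_comm]
  have h2 : ∀ y z, (∑ v : Fin 3 → F, if v ⬝ᵥ (z - y) = 0 then u y * u z else 0) =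
      (Fintype.card F : ℝ) ^ 2 * (u y * u z) +
        if y = z then ((Fintype.card F : ℝ) ^ 3 - Fintype.card F ^ 2) * (u y * u z) else 0 := by
    intro y z
    rw [← Finset.sum_filter, Finset.sum_const, nsmul_eq_mul]
    split_ifs with h
    · simp [h]; ring
    · rw [card_dotProduct_eq_zero (sub_ne_zero.2 (Ne.symm h))]; simp
  simp_rw [h2, Finset.sum_add_distrib]
  simp only [← Finset.mul_sum, Finset.sum_ite_eq, Finset.mem_univ, if_true, ← Finset.sum_mul]
  simp only [← sq]
  ring

/-- The sum over nonzero vectors of a function that is invariant under nonzero scalars is divisible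
by the number of nonzero scalars. -/
theorem card_sub_one_dvd_sum_ne_zero [DecidableEq F] {E : Type*} [AddCommGroup E] [Module F E]
    [Fintype E] [DecidableEq E] (S : E → ℤ) (hS : ∀ v (a : F), a ≠ 0 → S (a • v) = S v) :
    (Fintype.card F - 1 : ℤ) ∣ ∑ v with v ≠ 0, S v := by
  classical
  rw [← Finset.sum_fiberwise_of_maps_to (g := fun v : E => Submodule.span F {v})
    (fun v hv => Finset.mem_image_of_mem (fun v : E => Submodule.span F {v}) hv)]
  refine Finset.dvd_sum fun p hp => ?_
  obtain ⟨v, hv, rfl⟩ := Finset.mem_image.1 hp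
  have hv : v ≠ 0 := by simpa using hv
  have : ∑ a : Fˣ, S (a • v) =
      ∑ w ∈ {w ∈ Finset.univ.filter (fun w : E => w ≠ 0) |
        Submodule.span F {w} = Submodule.span F {v}}, S w := by
    refine Finset.sum_bij (fun a _ => a • v) ?_ ?_ ?_ fun _ _ => rfl
    · intro a _
      simp only [Finset.mem_filter, Finset.mem_univ, true_and]
      exact ⟨by simpa [Units.smul_def] using hv, Submodule.span_singleton_group_smul_eq F a v⟩
    · intro a _ b _ h
      exact Units.ext (smul_left_injective F hv h)
    · intro w hw
      obtain ⟨z, hz⟩ := Submodule.span_singleton_eq_span_singleton.1 (Finset.mem_filter.1 hw).2.symm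
      exact ⟨z, Finset.mem_univ _, hz⟩
  rw [← this, Finset.sum_congr rfl fun (a : Fˣ) _ => show S (a • v) = S v from hS v a a.ne_zero]
  simp [Fintype.card_units, Nat.cast_sub (Fintype.card_pos (α := F))]

/-- The modular equality for a weight on the points of `AG(3,q)` with all line sums `0` or `1`. -/
theorem two_mul_card_add_one_dvd_of_line_sums (u : (Fin 3 → F) → ℝ)
    (hu : ∀ y d, d ≠ 0 → ∑ t : F, u (y + t • d) = 0 ∨ ∑ t : F, u (y + t • d) = 1)
    (x : ℕ) (hx : ∑ y, u y = x) : 2 * (Fintype.card F + 1) ∣ x * (x - 1) := by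
  classical
  choose m hm using exists_intCast_of_line_sums u hu
  have hm1 : ∀ v, ∑ c, m v c = x := by
    intro v
    have : ((∑ c, m v c : ℤ) : ℝ) = (x : ℤ) := by
      push_cast
      rw [← hx, ← Finset.sum_fiberwise Finset.univ (fun y => v ⬝ᵥ y) u]
      exact Finset.sum_congr rfl fun c _ => (hm v c).symm
    exact_mod_cast this
  have hm0 : ∀ c, m 0 c = if c = 0 then (x : ℤ) else 0 := by
    intro c
    have : (m 0 c : ℝ) = ((if c = 0 then (x : ℤ) else 0 : ℤ) : ℝ) := by
      rw [← hm]
      split_ifs with h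
      · simp [h, hx]
      · simp [Ne.symm h]
    exact_mod_cast this
  have hms : ∀ v (a : F) c, a ≠ 0 → m (a • v) (a * c) = m v c := by
    intro v a c ha
    have : (m (a • v) (a * c) : ℝ) = m v c := by
      rw [← hm, ← hm]
      simp [ha]
    exact_mod_cast this
  let T : (Fin 3 → F) → ℤ := fun v => ∑ c, m v c * (m v c - 1) / 2
  have hT2 : ∀ v, 2 * T v = ∑ c, m v c ^ 2 - x := by
    intro v
    rw [← hm1 v, ← Finset.sum_sub_distrib, Finset.mul_sum]
    refine Finset.sum_congr rfl fun c _ => ?_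
    rw [Int.mul_ediv_cancel' (Int.even_mul_pred_self _).two_dvd]
    ring
  have hTs : ∀ v (a : F), a ≠ 0 → T (a • v) = T v := by
    intro v a ha
    simp only [T]
    rw [← Equiv.sum_comp (Equiv.mulLeft₀ a ha)]
    simp [hms v a _ ha]
  obtain ⟨Z, hZ⟩ := card_sub_one_dvd_sum_ne_zero T hTs
  have hT0 : 2 * T 0 = (x : ℤ) ^ 2 - x := by
    rw [hT2]; simp [hm0]
  have hsum : 2 * T 0 + 2 * ∑ v with v ≠ 0, T v =
      ∑ v, ∑ c, m v c ^ 2 - (Fintype.card F) ^ 3 * x := by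
    rw [Finset.filter_ne', ← mul_add, Finset.add_sum_erase _ _ (Finset.mem_univ _), Finset.mul_sum,
      Finset.sum_congr rfl fun v _ => hT2 v]
    simp
  have h1 := sum_sq_of_line_sums u hu
  have h2 := sum_plane_sums_sq u
  simp_rw [hm] at h2
  rw [hx] at h1 h2
  rw [hT0, hZ] at hsum
  have hsumR := congrArg (Int.cast (R := ℝ)) hsum
  push_cast at hsumR
  rw [h2] at hsumR
  have hq1 : (1 : ℝ) < Fintype.card F := by exact_mod_cast Fintype.one_lt_card
  set q : ℝ := (Fintype.card F : ℝ)
  have key : (q + 1) * (2 * (Z : ℝ)) = (q ^ 2 + q + 1) * (x * (x - 1)) := by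
    apply mul_left_cancel₀ (sub_ne_zero.2 hq1.ne')
    linear_combination (q + 1) * hsumR - q * h1
  have keyZ : (2 * (Fintype.card F + 1) : ℤ) * Z =
      ((Fintype.card F : ℤ) ^ 2 + Fintype.card F + 1) * (x * (x - 1)) := by
    have : (((2 * (Fintype.card F + 1) : ℤ) * Z : ℤ) : ℝ) =
      ((((Fintype.card F : ℤ) ^ 2 + Fintype.card F + 1) * (x * (x - 1)) : ℤ) : ℝ) := by
      push_cast
      linear_combination key
    exact_mod_cast this
  have hcop : IsCoprime (2 * (Fintype.card F + 1) : ℤ)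
      ((Fintype.card F : ℤ) ^ 2 + Fintype.card F + 1) := by
    refine IsCoprime.mul_left ?_ ⟨-(Fintype.card F : ℤ), 1, by ring⟩
    obtain ⟨k, hk⟩ := (Int.even_mul_succ_self (Fintype.card F : ℤ)).two_dvd
    exact ⟨-k, 1, by linear_combination hk⟩
  have hdvd := hcop.dvd_of_dvd_mul_left ⟨Z, keyZ.symm⟩
  rcases Nat.eq_zero_or_pos x with rfl | hx0
  · simp
  · rw [← Int.natCast_dvd_natCast]
    push_cast [Nat.cast_sub hx0]
    exact hdvd

theorem natCard_linearIndependent_pair_mem {W : Type*} [AddCommGroup W] [Module F W] [Finite W]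
    (A : Submodule F W) (hA : 2 ≤ finrank F A) :
    Nat.card {s : Fin 2 → W // LinearIndependent F s ∧ ∀ i, s i ∈ A} =
      (Fintype.card F ^ finrank F A - 1) * (Fintype.card F ^ finrank F A - Fintype.card F) := by
  have h := card_linearIndependent (K := F) (V := A) hA
  rw [Fin.prod_univ_two] at h
  simp only [Fin.val_zero, Fin.val_one, pow_zero, pow_one] at h
  rw [← h]
  refine Nat.card_congr
    ⟨fun s => ⟨fun i => ⟨s.1 i, s.2.2 i⟩, ?_⟩, fun s => ⟨fun i => (s.1 i : W), ?_, ?_⟩,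
      fun s => rfl, fun s => rfl⟩
  · exact LinearIndependent.of_comp A.subtype s.2.1
  · exact s.2.map' A.subtype A.ker_subtype
  · exact fun i => (s.1 i).2

/-- Double counting of incidences between weighted vectors and subspaces of codimension two. -/
theorem sum_codim_two_mul {V : Type*} [AddCommGroup V] [Module F V] [Finite V]
    [Fintype (Submodule F V)] [DecidableEq F] {n : ℕ} (hn : 2 ≤ n) (hV : finrank F V = n + 1)
    (f : Submodule F V → ℝ) (w : V → ℝ) (S : Finset V) (hS : (0 : V) ∉ S)
    [∀ K : Submodule F V, DecidablePred (· ∈ K)]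
    (hf : ∀ K : Submodule F V, finrank F K + 2 = n + 1 → f K = ∑ v ∈ S with v ∈ K, w v) :
        (∑ K ∈ Finset.univ.filter (fun K : Submodule F V => finrank F K + 2 = n + 1), f K) *
        (((Fintype.card F : ℝ) ^ 2 - 1) * ((Fintype.card F : ℝ) ^ 2 - Fintype.card F)) =
      (∑ v ∈ S, w v) *
        (((Fintype.card F : ℝ) ^ n - 1) * ((Fintype.card F : ℝ) ^ n - Fintype.card F)) := by
  classical
  have : Finite (Dual F V) := Module.finite_of_finite F
  have := Fintype.ofFinite (Dual F V)
  have hq1 : 1 ≤ Fintype.card F := Fintype.card_pos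
  let G : Finset (Fin 2 → Dual F V) := Finset.univ.filter fun s => LinearIndependent F s
  let k : (Fin 2 → Dual F V) → Submodule F V := fun s =>
    (Submodule.span F (Set.range s)).dualCoannihilator
  have hcard : ∀ (A : Submodule F (Dual F V)) (m : ℕ), finrank F A = m → 2 ≤ m →
      ((G.filter fun s => ∀ i, s i ∈ A).card : ℝ) =
        ((Fintype.card F : ℝ) ^ m - 1) * ((Fintype.card F : ℝ) ^ m - Fintype.card F) := by
    rintro A m rfl hm
    have := natCard_linearIndependent_pair_mem A hm
    rw [Nat.card_eq_fintype_card, Fintype.card_subtype] at this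
    rw [Finset.filter_filter, this, Nat.cast_mul, Nat.cast_sub (Nat.one_le_pow _ _ hq1),
      Nat.cast_sub (Nat.le_self_pow (by omega) _)]
    push_cast
    rfl
  have hle : ∀ s (K : Submodule F V), K ≤ k s ↔ ∀ i, s i ∈ K.dualAnnihilator := by
    intro s K
    rw [← Submodule.le_dualAnnihilator_iff_le_dualCoannihilator, Submodule.span_le,
      Set.range_subset_iff]
    rfl
  have hk : ∀ s ∈ G, finrank F (k s) + 2 = n + 1 := by
    intro s hs
    have h1 := finrank_span_eq_card (Finset.mem_filter.1 hs).2
    have h2 := Subspace.finrank_add_finrank_dualCoannihilator_eq (Submodule.span F (Set.range s))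
    rw [h1, hV, Fintype.card_fin] at h2
    rw [← h2, add_comm]
  have hann := fun K : Submodule F V => Subspace.finrank_add_finrank_dualAnnihilator_eq K
  have e1 : ∑ s ∈ G, f (k s) =
      (∑ K ∈ Finset.univ.filter (fun K : Submodule F V => finrank F K + 2 = n + 1), f K) *
      (((Fintype.card F : ℝ) ^ 2 - 1) * ((Fintype.card F : ℝ) ^ 2 - Fintype.card F)) := by
    rw [← Finset.sum_fiberwise_of_maps_to (g := k)
      (t := Finset.univ.filter fun K : Submodule F V => finrank F K + 2 = n + 1)
      (fun s hs => by simpa using hk s hs), Finset.sum_mul]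
    refine Finset.sum_congr rfl fun K hK => ?_
    have hK : finrank F K + 2 = n + 1 := by simpa using hK
    rw [← hcard K.dualAnnihilator 2 (by have := hann K; omega) le_rfl,
      Finset.sum_congr rfl fun s hs => by rw [(Finset.mem_filter.1 hs).2], Finset.sum_const,
      nsmul_eq_mul, mul_comm]
    congr 3
    refine Finset.filter_congr fun s hs => ?_
    rw [← hle]
    refine ⟨fun h => h.ge, fun h => (Submodule.eq_of_le_of_finrank_eq h ?_).symm⟩
    have := hk s hs
    omega
  have e2 : ∑ s ∈ G, f (k s) = (∑ v ∈ S, w v) *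
      (((Fintype.card F : ℝ) ^ n - 1) * ((Fintype.card F : ℝ) ^ n - Fintype.card F)) := by
    rw [Finset.sum_congr rfl fun s hs => hf (k s) (hk s hs)]
    simp_rw [Finset.sum_filter]
    rw [Finset.sum_comm, Finset.sum_mul]
    refine Finset.sum_congr rfl fun v hv => ?_
    have hv0 : v ≠ 0 := fun h => hS (h ▸ hv)
    have h1 := hann (Submodule.span F {v})
    rw [finrank_span_singleton hv0] at h1
    rw [← Finset.sum_filter, Finset.sum_const, nsmul_eq_mul, mul_comm,
      ← hcard (Submodule.span F {v}).dualAnnihilator n (by omega) hn]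
    congr 3
    refine Finset.filter_congr fun s hs => ?_
    rw [← hle, Submodule.span_singleton_le_iff_mem]
  rw [← e1, e2]

end

theorem gaussBinom_add_two_mul {q : ℕ} (hq : 2 ≤ q) (m : ℕ) :
    gaussBinom q (m + 2) m * (((q : ℚ) - 1) * ((q : ℚ) ^ 2 - 1)) =
      ((q : ℚ) ^ (m + 1) - 1) * ((q : ℚ) ^ (m + 2) - 1) := by
  have hne : ∀ i, (q : ℚ) ^ (i + 1) - 1 ≠ 0 := fun i =>
    sub_ne_zero.2 (one_lt_pow₀ (by exact_mod_cast hq) (Nat.succ_ne_zero i)).ne'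
  have h1 : gaussBinom q (m + 2) m =
      ∏ i ∈ Finset.range m, ((q : ℚ) ^ (i + 3) - 1) / ((q : ℚ) ^ (i + 1) - 1) := by
    rw [gaussBinom, Finset.prod_div_distrib, Finset.prod_div_distrib,
      ← Finset.prod_range_reflect (fun i => (q : ℚ) ^ (i + 3) - 1)]
    congr 1
    refine Finset.prod_congr rfl fun i hi => ?_
    have := Finset.mem_range.1 hi
    congr 2
    omega
  rw [h1]
  clear h1
  induction m with
  | zero => simp
  | succ m ih =>
    rw [Finset.prod_range_succ, mul_right_comm, ih]
    have := hne m
    field_simp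

/-- Affine points correspond to vectors in the affine hyperplane `φ = 1`, where `φ` is a
functional with kernel the hyperplane at infinity. -/
theorem finsum_affPoint_eq_sum [DecidableEq F] {Hinf : Submodule F (Fin (n + 1) → F)}
    {φ : (Fin (n + 1) → F) →ₗ[F] F} (hφ : ∀ v, φ v = 0 ↔ v ∈ Hinf)
    (w : Submodule F (Fin (n + 1) → F) → ℝ) (K : Submodule F (Fin (n + 1) → F))
    [DecidablePred (· ∈ K)] :
    ∑ᶠ P ∈ {P | IsAffPoint Hinf P ∧ P ≤ K}, w P =
      ∑ v with φ v = 1 ∧ v ∈ K, w (Submodule.span F {v}) := by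
  rw [← finsum_mem_coe_finset]
  symm
  refine finsum_mem_eq_of_bijOn (fun v => Submodule.span F {v}) ⟨?_, ?_, ?_⟩ fun _ _ => rfl
  · intro v hv
    have hv : φ v = 1 ∧ v ∈ K := by simpa using hv
    have hv0 : v ≠ 0 := by rintro rfl; simp at hv
    refine ⟨⟨finrank_span_singleton hv0, ?_⟩, ?_⟩
    · rw [Submodule.span_singleton_le_iff_mem, ← hφ, hv.1]
      exact one_ne_zero
    · rw [Submodule.span_singleton_le_iff_mem]
      exact hv.2
  · intro v hv v' hv' h
    have hv : φ v = 1 ∧ v ∈ K := by simpa using hv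
    have hv' : φ v' = 1 ∧ v' ∈ K := by simpa using hv'
    obtain ⟨z, hz⟩ := Submodule.span_singleton_eq_span_singleton.1 h
    have : (z : F) = 1 := by
      have := congrArg φ hz
      simpa [Units.smul_def, hv.1, hv'.1] using this
    rw [← hz, Units.smul_def, this, one_smul]
  · rintro P ⟨⟨hP1, hP2⟩, hP3⟩
    obtain ⟨v, hv, hvH⟩ := SetLike.not_le_iff_exists.1 hP2
    rw [← hφ] at hvH
    have hspan : Submodule.span F {(φ v)⁻¹ • v} = P := by
      refine Submodule.eq_of_le_of_finrank_eq ?_ ?_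
      · rw [Submodule.span_singleton_le_iff_mem]
        exact P.smul_mem _ hv
      · rw [hP1, finrank_span_singleton]
        intro h
        have := congrArg φ h
        simp [hvH] at this
    refine ⟨(φ v)⁻¹ • v, ?_, hspan⟩
    have : (φ v)⁻¹ • v ∈ K := hP3 (P.smul_mem _ hv)
    simpa [hvH] using this

theorem statement16 (q x : ℕ) (hq : IsPrimePow q) (hF : Fintype.card F = q)
    (hn : 3 ≤ n)
    (Hinf : Submodule F (Fin (n + 1) → F)) (hH : Module.finrank F Hinf = n)
    (L : Set (Submodule F (Fin (n + 1) → F)))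
    (hL : IsCLAff (n - 2) Hinf L)
    (hcard : (L.ncard : ℚ) = (x : ℚ) * gaussBinom q n (n - 2)) :
    2 * (q + 1) ∣ x * (x - 1) := by
  classical
  obtain ⟨hLaff, w, hw⟩ := hL
  have := Fintype.ofFinite (Submodule F (Fin (n + 1) → F))
  obtain ⟨φ, g, hφ, hsurj⟩ := exists_coordinates hn Hinf hH (finrank_fin_fun F)
  have hind : ∀ K : Submodule F (Fin (n + 1) → F), finrank F K + 2 = n + 1 →
      L.indicator (fun _ => (1 : ℝ)) K =
        ∑ v with φ v = 1 ∧ v ∈ K, w (Submodule.span F {v}) := by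
    intro K hK
    by_cases hKH : K ≤ Hinf
    · rw [Set.indicator_of_notMem fun h => (hLaff K h).2 hKH, Finset.filter_false_of_mem,
        Finset.sum_empty]
      rintro v - ⟨h1, h2⟩
      rw [(hφ v).2 (hKH h2)] at h1
      exact zero_ne_one h1
    · rw [hw K ⟨by omega, hKH⟩, finsum_affPoint_eq_sum hφ]
  have hLcard : ∑ K ∈ Finset.univ.filter
      (fun K : Submodule F (Fin (n + 1) → F) => finrank F K + 2 = n + 1),
      L.indicator (fun _ => (1 : ℝ)) K = L.ncard := by
    rw [Set.ncard_eq_toFinset_card', Finset.sum_indicator_eq_sum_filter, Finset.sum_const,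
      nsmul_one]
    congr 2
    ext K
    simp only [Finset.mem_filter, Finset.mem_univ, true_and, Set.mem_toFinset]
    exact ⟨fun h => h.2, fun h => ⟨by have := (hLaff K h).1; omega, h⟩⟩
  have htotal : ∑ v with φ v = 1, w (Submodule.span F {v}) = x := by
    have h1 := sum_codim_two_mul (by omega) (finrank_fin_fun F)
      (L.indicator fun _ => (1 : ℝ)) (fun v => w (Submodule.span F {v}))
      (Finset.univ.filter fun v => φ v = 1) (by simp)
      (fun K hK => by rw [hind K hK, Finset.filter_filter])
    have hq2 : 2 ≤ q := hq.two_le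
    obtain ⟨m, rfl⟩ : ∃ m, n = m + 2 := ⟨n - 2, by omega⟩
    have h2 := gaussBinom_add_two_mul hq2 m
    rw [Nat.add_sub_cancel] at hcard
    have h3 : (L.ncard : ℚ) * (((q : ℚ) ^ 2 - 1) * ((q : ℚ) ^ 2 - q)) =
        x * (((q : ℚ) ^ (m + 2) - 1) * ((q : ℚ) ^ (m + 2) - q)) := by
      rw [hcard]
      linear_combination x * q * h2
    have h4 : (L.ncard : ℝ) * (((q : ℝ) ^ 2 - 1) * ((q : ℝ) ^ 2 - q)) =
        x * (((q : ℝ) ^ (m + 2) - 1) * ((q : ℝ) ^ (m + 2) - q)) := by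
      exact_mod_cast congrArg (Rat.cast (K := ℝ)) h3
    rw [hLcard, hF, h4] at h1
    have hq1 : (1 : ℝ) < q := by exact_mod_cast hq2
    refine (mul_right_cancel₀ (mul_ne_zero ?_ ?_) h1).symm
    · exact sub_ne_zero.2 (one_lt_pow₀ hq1 (by omega)).ne'
    · exact sub_ne_zero.2 (lt_self_pow₀ hq1 (by omega)).ne'
  rw [← hF]
  refine two_mul_card_add_one_dvd_of_line_sums
    (fun y => ∑ v with φ v = 1 ∧ g v = y, w (Submodule.span F {v})) ?_ x ?_
  · intro y d hd
    set K := (Submodule.span F {((1 : F), y), ((0 : F), d)}).comap (φ.prod g) with hK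
    have hrank := finrank_comap_span_pair (φ.prod g) hsurj y hd
    rw [finrank_fin_fun, finrank_fin_fun, ← hK] at hrank
    have hsum : ∑ t : F, ∑ v with φ v = 1 ∧ g v = y + t • d, w (Submodule.span F {v}) =
        L.indicator (fun _ => (1 : ℝ)) K := by
      rw [hind K (by omega)]
      simp_rw [Finset.sum_filter]
      rw [Finset.sum_comm]
      refine Finset.sum_congr rfl fun v _ => ?_
      have hmem : φ v = 1 → (v ∈ K ↔ ∃ t : F, g v = y + t • d) := fun h => by
        rw [hK, Submodule.mem_comap, LinearMap.prod_apply, Function.prod_apply, h, mem_span_pair_iff]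
      split_ifs with h
      · obtain ⟨t, ht⟩ := (hmem h.1).1 h.2
        rw [Finset.sum_eq_single t, if_pos ⟨h.1, ht⟩]
        · rintro s - hs
          refine if_neg fun h' => hs (smul_left_injective F hd ?_)
          exact add_left_cancel (h'.2.symm.trans ht)
        · exact fun h => absurd (Finset.mem_univ _) h
      · exact Finset.sum_eq_zero fun t _ => if_neg fun h' => h ⟨h'.1, (hmem h'.1).2 ⟨t, h'.2⟩⟩
    rw [hsum, Set.indicator_apply]
    split_ifs <;> simp
  · rw [← htotal, ← Finset.sum_fiberwise (Finset.univ.filter fun v => φ v = 1) g]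
    simp_rw [Finset.filter_filter]
end

section
/- Let q be a prime power, F a finite field with q elements, k ≥ 1 and n ≥ k+2. There does not exist a Cameron–Liebler k-set 𝓛 of AG(n,q) with |𝓛| = 2·[n k]_q, i.e. with parameter x = 2. -/
open Module

variable {F : Type} [Field F] [Fintype F] {n : ℕ}

set_option linter.unusedSectionVars false

section LineSums

variable {Y : Type*} [AddCommGroup Y] [Module F Y] [Fintype Y]

lemma sum_add_smul {t : F} (ht : t ≠ 0) (f : Y → ℝ) (v : Y) :
    ∑ d, f (v + t • d) = ∑ y, f y :=
  ((MulAction.bijective₀ ht).sum_comp fun d => f (v + d)).trans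
    ((AddGroup.addLeft_bijective v).sum_comp f)

/-- The sum of `f` over all lines through `v`, counted by their nonzero direction vectors. -/
lemma sum_lines_through [DecidableEq Y] (f : Y → ℝ) (v : Y) :
    ∑ d ∈ {d : Y | d ≠ 0}, ∑ t : F, f (v + t • d) =
      (Fintype.card Y - Fintype.card F : ℝ) * f v + (Fintype.card F - 1 : ℝ) * ∑ y, f y := by
  classical
  have h1 : ∑ d : Y, ∑ t : F, f (v + t • d) =
      Fintype.card Y * f v + (Fintype.card F - 1 : ℝ) * ∑ y, f y := by
    rw [Finset.sum_comm, ← Finset.add_sum_erase _ _ (Finset.mem_univ (0 : F)),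
      Finset.sum_congr rfl fun t ht => sum_add_smul (Finset.ne_of_mem_erase ht) f v]
    simp [Finset.card_erase_of_mem, Nat.cast_sub Fintype.card_pos]
  rw [← Finset.add_sum_erase _ _ (Finset.mem_univ (0 : Y))] at h1
  rw [Finset.filter_ne']
  simp only [smul_zero, add_zero, Finset.sum_const, Finset.card_univ, nsmul_eq_mul] at h1
  linarith

/-- If all line sums are `0` or `1`, then `f` takes values in `ℤ / q`. -/
lemma exists_int_eq_card_mul (hY : 2 ≤ finrank F Y) (f : Y → ℝ)
    (hf : ∀ v d : Y, d ≠ 0 → ∑ t : F, f (v + t • d) = 0 ∨ ∑ t : F, f (v + t • d) = 1) (v : Y) :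
    ∃ z : ℤ, Fintype.card F * f v = z := by
  classical
  have hint : ∀ v d : Y, d ≠ 0 → ∃ z : ℤ, ∑ t : F, f (v + t • d) = z := fun v d hd =>
    (hf v d hd).elim (fun h => ⟨0, by simp [h]⟩) (fun h => ⟨1, by simp [h]⟩)
  have : Nontrivial Y := nontrivial_of_finrank_pos (R := F) (by omega)
  obtain ⟨x, hx⟩ := exists_ne (0 : Y)
  obtain ⟨y, hxy⟩ := exists_linearIndependent_pair_of_one_lt_finrank (R := F) (by omega) hx
  have hne (a : F) : y + a • x ≠ 0 := fun h => by
    have := LinearIndependent.pair_iff.1 hxy a 1 (by rw [one_smul, add_comm, h])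
    exact one_ne_zero this.2
  choose z hz using fun a => hint v (y + a • x) (hne a)
  choose z' hz' using fun t : F => hint (v + t • y) x hx
  refine ⟨∑ a, z a - ∑ t ∈ Finset.univ.erase 0, z' t, ?_⟩
  have key : ∑ a : F, ∑ t : F, f (v + t • (y + a • x)) = Fintype.card F * f v +
      ∑ t ∈ Finset.univ.erase (0 : F), ∑ b : F, f (v + t • y + b • x) := by
    rw [Finset.sum_comm, ← Finset.add_sum_erase _ _ (Finset.mem_univ (0 : F))]
    congr 1
    · simp
    · refine Finset.sum_congr rfl fun t ht => ?_
      have ht0 := Finset.ne_of_mem_erase ht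
      rw [← (mulLeft_bijective₀ t ht0).sum_comp fun b => f (v + t • y + b • x)]
      simp [smul_add, smul_smul, add_assoc]
  push_cast
  simp only [← hz, ← hz']
  linarith

theorem sum_ne_two_of_line_sums (hY : 3 ≤ finrank F Y) (f : Y → ℝ)
    (hf : ∀ v d : Y, d ≠ 0 → ∑ t : F, f (v + t • d) = 0 ∨ ∑ t : F, f (v + t • d) = 1) :
    ∑ y, f y ≠ 2 := by
  classical
  intro hT
  obtain ⟨m, hm⟩ : ∃ m, finrank F Y = m + 3 := ⟨_, (Nat.sub_add_cancel hY).symm⟩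
  set q := Fintype.card F with hq
  have hq2 : (2 : ℤ) ≤ q := by exact_mod_cast Fintype.one_lt_card (α := F)
  have hcard : Fintype.card Y = q * q ^ (m + 2) := by
    rw [Module.card_eq_pow_finrank (K := F), hm]; ring
  obtain ⟨M, hM⟩ : ∃ M : ℤ, M = q ^ (m + 2) - 1 := ⟨_, rfl⟩
  have hMq : 3 * ((q : ℤ) - 1) ≤ M := by
    have h1 : (q : ℤ) ^ 2 ≤ q ^ (m + 2) := pow_le_pow_right₀ (by omega) (by omega)
    nlinarith
  have hlines (v : Y) (z : ℤ) (hz : q * f v = z) :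
      ∑ d ∈ {d : Y | d ≠ 0}, ∑ t : F, f (v + t • d) = ((M * z + 2 * (q - 1) : ℤ) : ℝ) := by
    rw [sum_lines_through, hT, hcard, hM]
    push_cast
    rw [← hz]
    ring
  have hnonneg (v : Y) : 0 ≤ f v := by
    obtain ⟨z, hz⟩ := exists_int_eq_card_mul (by omega) f hf v
    have h0 : 0 ≤ M * z + 2 * ((q : ℤ) - 1) := by
      have : (0 : ℝ) ≤ ((M * z + 2 * (q - 1) : ℤ) : ℝ) := by
        rw [← hlines v z hz]
        refine Finset.sum_nonneg fun d hd => ?_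
        rcases hf v d (by simpa using hd) with h | h <;> simp [h]
      exact_mod_cast this
    have hz0 : 0 ≤ z := by
      by_contra! h
      nlinarith
    have hqR : (0 : ℝ) < q := by exact_mod_cast Fintype.card_pos
    have : (0 : ℝ) ≤ q * f v := by rw [hz]; exact_mod_cast hz0
    exact nonneg_of_mul_nonneg_right this hqR
  obtain ⟨v, -, hv⟩ := Finset.exists_ne_zero_of_sum_ne_zero (s := (Finset.univ : Finset Y)) (f := f)
    (by rw [hT]; norm_num)
  obtain ⟨z, hz⟩ := exists_int_eq_card_mul (by omega) f hf v
  have hone (d : Y) (hd : d ≠ 0) : ∑ t : F, f (v + t • d) = 1 := by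
    refine (hf v d hd).resolve_left fun h => hv ?_
    have := (Finset.sum_eq_zero_iff_of_nonneg fun t _ => hnonneg _).1 h 0 (Finset.mem_univ _)
    simpa using this
  have hsum := hlines v z hz
  rw [Finset.sum_congr rfl fun d hd => hone d (by simpa using hd), Finset.filter_ne'] at hsum
  have hcount : ((q : ℤ) * q ^ (m + 2) - 1) = M * z + 2 * (q - 1) := by
    have : ((q : ℝ) * q ^ (m + 2) - 1) = ((M * z + 2 * (q - 1) : ℤ) : ℝ) := by
      rw [← hsum, Finset.sum_const, Finset.card_erase_of_mem (Finset.mem_univ _),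
        Finset.card_univ, nsmul_eq_mul, Nat.cast_sub Fintype.card_pos, hcard]
      push_cast
      ring
    exact_mod_cast this
  have hdiv : M * (q - z) = q - 1 := by rw [hM] at hcount ⊢; linarith
  have hpos : 0 < (q : ℤ) - z := by
    by_contra! h
    nlinarith
  nlinarith

end LineSums

section FlatSums

variable {X : Type*} [AddCommGroup X] [Module F X] [Fintype X]

theorem sum_ne_two_of_flat_sums {k : ℕ} (hk : 1 ≤ k) (hX : k + 2 ≤ finrank F X) (f : X → ℝ)
    (hf : ∀ (U : Submodule F X) (v : X), finrank F U = k →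
      ∑ᶠ u : U, f (v + u) = 0 ∨ ∑ᶠ u : U, f (v + u) = 1) :
    ∑ x, f x ≠ 2 := by
  classical
  obtain ⟨b, hb⟩ := exists_linearIndependent_of_le_finrank (R := F) (M := X) (n := k - 1)
    (by omega)
  set W := Submodule.span F (Set.range b)
  have hW : finrank F W = k - 1 := by simpa using finrank_span_eq_card hb
  obtain ⟨C, hC⟩ := W.exists_isCompl
  have hWC := Submodule.finrank_add_eq_of_isCompl hC
  have hsum : ∑ x, f x = ∑ c : C, ∑ w : W, f (c + w) := by
    rw [← Fintype.sum_prod_type',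
      ← (Submodule.prodEquivOfIsCompl C W hC.symm).bijective.sum_comp f]
    rfl
  rw [hsum]
  refine sum_ne_two_of_line_sums (F := F) (by omega) _ fun c d hd => ?_
  set U := W ⊔ Submodule.span F {(d : X)}
  have hd' : (d : X) ≠ 0 := by simpa using hd
  have hdis : W ⊓ Submodule.span F {(d : X)} = ⊥ :=
    (hC.disjoint.mono_right (by simp)).eq_bot
  have hU : finrank F U = k := by
    have : finrank F U + _ = _ :=
      Submodule.finrank_sup_add_finrank_inf_eq W (Submodule.span F {(d : X)})
    rw [hdis, finrank_bot, finrank_span_singleton hd', hW] at this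
    omega
  let g : F × W → U := fun p => ⟨p.1 • (d : X) + p.2, add_mem
    (Submodule.mem_sup_right (Submodule.smul_mem _ _ (Submodule.mem_span_singleton_self _)))
    (Submodule.mem_sup_left p.2.2)⟩
  have hg : Function.Bijective g := by
    refine ⟨fun ⟨t, w⟩ ⟨t', w'⟩ h => ?_, fun ⟨u, hu⟩ => ?_⟩
    · have h1 : t • (d : X) + w = t' • (d : X) + w' := congrArg Subtype.val h
      have h2 : (t - t') • (d : X) = w' - w := by
        rw [sub_smul, sub_eq_sub_iff_add_eq_add, h1, add_comm]
      have h3 : (t - t') • (d : X) = 0 := by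
        refine (Submodule.mem_bot F).1 (hdis ▸ Submodule.mem_inf.2 ⟨?_, ?_⟩)
        · rw [h2]; exact sub_mem w'.2 w.2
        · exact Submodule.smul_mem _ _ (Submodule.mem_span_singleton_self _)
      have h4 : t = t' := sub_eq_zero.1 ((smul_eq_zero.1 h3).resolve_right hd')
      subst h4
      simpa using h1
    · obtain ⟨w, hw, y, hy, rfl⟩ := Submodule.mem_sup.1 hu
      obtain ⟨t, rfl⟩ := Submodule.mem_span_singleton.1 hy
      exact ⟨(t, ⟨w, hw⟩), Subtype.ext (add_comm _ _)⟩
  have key : ∑ t : F, ∑ w : W, f (↑(c + t • d) + w) = ∑ᶠ u : U, f (c + u) := by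
    rw [finsum_eq_sum_of_fintype, ← hg.sum_comp, Fintype.sum_prod_type]
    simp [g, add_assoc]
  rw [key]
  exact hf U c hU

/-- Counting linearly independent `k`-tuples by the subspace they span. -/
lemma card_grassmannian_mul {k : ℕ} (hk : k ≤ finrank F X) :
    Nat.card {U : Submodule F X // finrank F U = k} *
        ∏ i : Fin k, (Fintype.card F ^ k - Fintype.card F ^ i.val) =
      ∏ i : Fin k, (Fintype.card F ^ finrank F X - Fintype.card F ^ i.val) := by
  classical
  rw [← card_linearIndependent (K := F) (V := X) hk]
  let g : {s : Fin k → X // LinearIndependent F s} → {U : Submodule F X // finrank F U = k} :=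
    fun s => ⟨Submodule.span F (Set.range s.1), by simpa using finrank_span_eq_card s.2⟩
  have hfib (U : {U : Submodule F X // finrank F U = k}) :
      Nat.card {s // g s = U} = ∏ i : Fin k, (Fintype.card F ^ k - Fintype.card F ^ i.val) := by
    obtain ⟨U, hU⟩ := U
    have hc := card_linearIndependent (K := F) (V := U) hU.ge
    rw [hU] at hc
    rw [← hc]
    have hmem (s : {s // g s = ⟨U, hU⟩}) (i : Fin k) : s.1.1 i ∈ U := by
      have : Submodule.span F (Set.range s.1.1) = U := congrArg Subtype.val s.2
      exact this.le (Submodule.subset_span ⟨i, rfl⟩)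
    refine Nat.card_congr
      { toFun := fun s => ⟨fun i => ⟨s.1.1 i, hmem s i⟩,
          LinearIndependent.of_comp U.subtype s.1.2⟩
        invFun := fun s => ⟨⟨fun i => s.1 i, s.2.map' U.subtype U.ker_subtype⟩,
          Subtype.ext (Submodule.eq_of_le_of_finrank_eq ?_ ?_)⟩
        left_inv := fun s => rfl
        right_inv := fun s => rfl }
    · exact Submodule.span_le.2 (by rintro _ ⟨i, rfl⟩; exact (s.1 i).2)
    · rw [hU]
      exact (finrank_span_eq_card (s.2.map' U.subtype U.ker_subtype)).trans (Fintype.card_fin k)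
  rw [Nat.card_congr (Equiv.sigmaFiberEquiv g).symm, Nat.card_sigma, Finset.sum_congr rfl
    fun U _ => hfib U]
  simp [Nat.card_eq_fintype_card]

theorem card_grassmannian {k : ℕ} (hk : k ≤ finrank F X) :
    (Nat.card {U : Submodule F X // finrank F U = k} : ℚ) =
      gaussBinom (Fintype.card F) (finrank F X) k := by
  set q := Fintype.card F with hq
  have hq1 : (1 : ℚ) < q := by exact_mod_cast Fintype.one_lt_card (α := F)
  have hcast (m : ℕ) (hm : k ≤ m) : ((∏ i : Fin k, (q ^ m - q ^ i.val) : ℕ) : ℚ) =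
      (∏ i ∈ Finset.range k, (q : ℚ) ^ i) * ∏ i ∈ Finset.range k, ((q : ℚ) ^ (m - i) - 1) := by
    rw [Fin.prod_univ_eq_prod_range (fun i => q ^ m - q ^ i), ← Finset.prod_mul_distrib]
    push_cast
    refine Finset.prod_congr rfl fun i hi => ?_
    have him : i ≤ m := (Finset.mem_range.1 hi).le.trans hm
    rw [Nat.cast_sub (Nat.pow_le_pow_right Fintype.card_pos him), mul_sub, ← pow_add,
      Nat.add_sub_cancel' him]
    push_cast
    ring
  have h := congrArg (Nat.cast : ℕ → ℚ) (card_grassmannian_mul hk)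
  rw [Nat.cast_mul, hcast k le_rfl, hcast _ hk] at h
  have hreflect : ∏ i ∈ Finset.range k, ((q : ℚ) ^ (k - i) - 1) =
      ∏ i ∈ Finset.range k, ((q : ℚ) ^ (i + 1) - 1) := by
    rw [← Finset.prod_range_reflect]
    refine Finset.prod_congr rfl fun i hi => ?_
    have := Finset.mem_range.1 hi
    congr 2
    omega
  have h1 : ∏ i ∈ Finset.range k, (q : ℚ) ^ i ≠ 0 :=
    Finset.prod_ne_zero_iff.2 fun i _ => by positivity
  have h2 : ∏ i ∈ Finset.range k, ((q : ℚ) ^ (i + 1) - 1) ≠ 0 :=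
    Finset.prod_ne_zero_iff.2 fun i _ => (sub_pos.2 (one_lt_pow₀ hq1 i.succ_ne_zero)).ne'
  rw [hreflect, mul_left_comm] at h
  rw [gaussBinom, Finset.prod_div_distrib, eq_div_iff h2]
  exact mul_left_cancel₀ h1 h

end FlatSums

section AffineModel

variable {H : Submodule F (Fin (n + 1) → F)} {φ : (Fin (n + 1) → F) →ₗ[F] F}
  {e : Fin (n + 1) → F}

/-- The affine space through the affine point `⟨e + h⟩` with space at infinity `U`. -/
def flat (e : Fin (n + 1) → F) (h : H) (U : Submodule F H) : Submodule F (Fin (n + 1) → F) :=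
  Submodule.span F {e + (h : Fin (n + 1) → F)} ⊔ U.map H.subtype

lemma mem_iff_apply_eq_zero (hφ : LinearMap.ker φ = H) {x : Fin (n + 1) → F} :
    x ∈ H ↔ φ x = 0 := by
  rw [← hφ, LinearMap.mem_ker]

lemma mem_flat (hφ : LinearMap.ker φ = H) (he : φ e = 1) {h : H} {U : Submodule F H}
    {x : Fin (n + 1) → F} :
    x ∈ flat e h U ↔ ∃ u ∈ U, x = φ x • (e + (h : Fin (n + 1) → F)) + u := by
  have hH (y : H) : φ y = 0 := (mem_iff_apply_eq_zero hφ).1 y.2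
  constructor
  · intro hx
    obtain ⟨y, hy, z, ⟨u, hu, rfl⟩, rfl⟩ := Submodule.mem_sup.1 hx
    obtain ⟨c, rfl⟩ := Submodule.mem_span_singleton.1 hy
    refine ⟨u, hu, ?_⟩
    simp [he, hH]
  · rintro ⟨u, hu, hx⟩
    rw [hx]
    exact add_mem (Submodule.mem_sup_left
      (Submodule.smul_mem _ _ (Submodule.mem_span_singleton_self _)))
      (Submodule.mem_sup_right ⟨u, hu, rfl⟩)

lemma add_mem_flat (h : H) {U : Submodule F H} {u : H} (hu : u ∈ U) :
    e + (↑(h + u) : Fin (n + 1) → F) ∈ flat e h U := by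
  rw [Submodule.coe_add, ← add_assoc]
  exact add_mem (Submodule.mem_sup_left (Submodule.mem_span_singleton_self _))
    (Submodule.mem_sup_right ⟨u, hu, rfl⟩)

lemma comap_flat (hφ : LinearMap.ker φ = H) (he : φ e = 1) (h : H) (U : Submodule F H) :
    (flat e h U).comap H.subtype = U := by
  ext y
  have hy : φ y = 0 := (mem_iff_apply_eq_zero hφ).1 y.2
  simp [mem_flat hφ he, hy]

lemma add_notMem (hφ : LinearMap.ker φ = H) (he : φ e = 1) (h : H) :
    e + (h : Fin (n + 1) → F) ∉ H := by
  have hh : φ h = 0 := (mem_iff_apply_eq_zero hφ).1 h.2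
  rw [mem_iff_apply_eq_zero hφ]
  simp [he, hh]

lemma flat_not_le (hφ : LinearMap.ker φ = H) (he : φ e = 1) (h : H) (U : Submodule F H) :
    ¬ flat e h U ≤ H := fun hle =>
  add_notMem hφ he h (hle (Submodule.mem_sup_left (Submodule.mem_span_singleton_self _)))

lemma finrank_flat (hφ : LinearMap.ker φ = H) (he : φ e = 1) (h : H) (U : Submodule F H) :
    finrank F (flat e h U) = finrank F U + 1 := by
  have hne : e + (h : Fin (n + 1) → F) ≠ 0 := fun h0 =>
    add_notMem hφ he h (h0 ▸ H.zero_mem)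
  have hdis : Submodule.span F {e + (h : Fin (n + 1) → F)} ⊓ U.map H.subtype = ⊥ := by
    rw [eq_bot_iff]
    rintro x ⟨hx, ⟨u, -, rfl⟩⟩
    obtain ⟨c, hc⟩ := Submodule.mem_span_singleton.1 hx
    have hcu : c • (e + (h : Fin (n + 1) → F)) ∈ H := hc ▸ u.2
    rcases eq_or_ne c 0 with rfl | hc0
    · simpa using hc.symm
    · exact absurd ((H.smul_mem_iff hc0).1 hcu) (add_notMem hφ he h)
  have := Submodule.finrank_sup_add_finrank_inf_eq
    (Submodule.span F {e + (h : Fin (n + 1) → F)}) (U.map H.subtype)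
  rw [hdis, finrank_bot, finrank_span_singleton hne,
    Submodule.finrank_map_subtype_eq] at this
  rw [flat]
  omega

lemma flat_comap (hφ : LinearMap.ker φ = H) (he : φ e = 1)
    {K : Submodule F (Fin (n + 1) → F)} {h : H} (hK : e + (h : Fin (n + 1) → F) ∈ K) :
    flat e h (K.comap H.subtype) = K := by
  refine le_antisymm (sup_le ?_ (Submodule.map_comap_le _ _)) fun x hx => ?_
  · rwa [Submodule.span_singleton_le_iff_mem]
  · have hh : φ h = 0 := (mem_iff_apply_eq_zero hφ).1 h.2
    have hxH : x - φ x • (e + (h : Fin (n + 1) → F)) ∈ H := by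
      rw [mem_iff_apply_eq_zero hφ]
      simp [he, hh]
    exact (mem_flat hφ he).2 ⟨⟨_, hxH⟩, sub_mem hx (K.smul_mem _ hK), by simp⟩

lemma exists_add_mem (hφ : LinearMap.ker φ = H) (he : φ e = 1)
    {K : Submodule F (Fin (n + 1) → F)} (hK : ¬ K ≤ H) :
    ∃ h : H, e + (h : Fin (n + 1) → F) ∈ K := by
  obtain ⟨x, hx, hxH⟩ := SetLike.not_le_iff_exists.1 hK
  have hx0 : φ x ≠ 0 := by rwa [mem_iff_apply_eq_zero hφ] at hxH
  refine ⟨⟨(φ x)⁻¹ • x - e, ?_⟩, ?_⟩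
  · rw [mem_iff_apply_eq_zero hφ]
    simp [he, hx0]
  · simpa using K.smul_mem _ hx

lemma span_add_injective (hφ : LinearMap.ker φ = H) (he : φ e = 1) :
    Function.Injective fun h : H => Submodule.span F {e + (h : Fin (n + 1) → F)} := by
  intro h h' heq
  have hmem : e + (h : Fin (n + 1) → F) ∈ flat e h' ⊥ :=
    Submodule.mem_sup_left (heq.le (Submodule.mem_span_singleton_self _))
  obtain ⟨u, hu, hx⟩ := (mem_flat hφ he).1 hmem
  have hh : φ h = 0 := (mem_iff_apply_eq_zero hφ).1 h.2
  rw [(Submodule.mem_bot F).1 hu] at hx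
  simpa [he, hh] using hx

/-- The affine points of a flat are the points `⟨e + h + u⟩` with `u` in its space at infinity. -/
lemma affPoints_flat (hφ : LinearMap.ker φ = H) (he : φ e = 1) (h : H) (U : Submodule F H) :
    {P | IsAffPoint H P ∧ P ≤ flat e h U} =
      Set.range fun u : U => Submodule.span F {e + (↑(h + u) : Fin (n + 1) → F)} := by
  ext P
  constructor
  · rintro ⟨⟨hP1, hPH⟩, hP⟩
    obtain ⟨y, hy⟩ := exists_add_mem hφ he hPH
    have hyne : e + (y : Fin (n + 1) → F) ≠ 0 := fun h0 =>
      add_notMem hφ he y (h0 ▸ H.zero_mem)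
    obtain ⟨u, hu, hx⟩ := (mem_flat hφ he).1 (hP hy)
    have hyφ : φ y = 0 := (mem_iff_apply_eq_zero hφ).1 y.2
    have hyu : y = h + u := by
      rw [map_add, he, hyφ, add_zero, one_smul, add_assoc] at hx
      exact Subtype.ext (add_left_cancel hx)
    refine ⟨⟨u, hu⟩, ?_⟩
    refine Submodule.eq_of_le_of_finrank_eq ?_ ?_
    · rw [Submodule.span_singleton_le_iff_mem]
      exact hyu ▸ hy
    · rw [hP1]
      exact finrank_span_singleton (hyu ▸ hyne)
  · rintro ⟨u, rfl⟩
    refine ⟨⟨finrank_span_singleton fun h0 => ?_, fun hle => ?_⟩, ?_⟩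
    · exact add_notMem hφ he (h + u) (h0 ▸ H.zero_mem)
    · exact add_notMem hφ he (h + u) (hle (Submodule.mem_span_singleton_self _))
    · exact (Submodule.span_singleton_le_iff_mem _ _).2 (add_mem_flat h u.2)

lemma finsum_affPoints_flat (hφ : LinearMap.ker φ = H) (he : φ e = 1) (h : H)
    (U : Submodule F H) (w : Submodule F (Fin (n + 1) → F) → ℝ) :
    ∑ᶠ P ∈ {P | IsAffPoint H P ∧ P ≤ flat e h U}, w P =
      ∑ᶠ u : U, w (Submodule.span F {e + (↑(h + u) : Fin (n + 1) → F)}) := by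
  rw [affPoints_flat hφ he, finsum_mem_range]
  intro u u' huu'
  exact Subtype.ext (add_left_cancel (span_add_injective hφ he huu'))

/-- Every affine `k`-space is `flat e h U` for exactly `q ^ k` pairs `(U, h)`. -/
lemma card_pairs_flat_mem (hφ : LinearMap.ker φ = H) (he : φ e = 1) {k : ℕ}
    {L : Set (Submodule F (Fin (n + 1) → F))} (hL : ∀ K ∈ L, IsAffSub k H K) :
    Nat.card {p : {U : Submodule F H // finrank F U = k} × H // flat e p.2 p.1.1 ∈ L} =
      L.ncard * Fintype.card F ^ k := by
  classical
  let g : {p : {U : Submodule F H // finrank F U = k} × H // flat e p.2 p.1.1 ∈ L} → L :=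
    fun p => ⟨_, p.2⟩
  have hfib (K : L) : Nat.card {p // g p = K} = Fintype.card F ^ k := by
    obtain ⟨K, hK⟩ := K
    obtain ⟨hKk, hKH⟩ := hL K hK
    obtain ⟨h, hh⟩ := exists_add_mem hφ he hKH
    have hKe := flat_comap hφ he hh
    set U := K.comap H.subtype with hU
    have hUk : finrank F U = k := by
      have := finrank_flat hφ he h U
      rw [hKe] at this
      omega
    have hflat (u : U) : flat e (h + (u : H)) U = K :=
      flat_comap hφ he (hKe.le (add_mem_flat h u.2))
    let s : U → {p // g p = ⟨K, hK⟩} := fun u =>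
      ⟨⟨(⟨U, hUk⟩, h + (u : H)), (hflat u).symm ▸ hK⟩, Subtype.ext (hflat u)⟩
    have hs : Function.Bijective s := by
      refine ⟨fun u u' huu' => ?_, fun ⟨⟨⟨⟨U', hU'⟩, h'⟩, hp⟩, hpK⟩ => ?_⟩
      · have : h + (u : H) = h + u' := congrArg (fun p => p.1.1.2) huu'
        exact Subtype.ext (add_left_cancel this)
      · have hflat' : flat e h' U' = K := congrArg Subtype.val hpK
        have hUU' : U' = U := by rw [hU, ← hflat', comap_flat hφ he]
        subst hUU'
        have hh' : e + (h' : Fin (n + 1) → F) ∈ K := by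
          rw [← hflat']
          exact Submodule.mem_sup_left (Submodule.mem_span_singleton_self _)
        have hmem : h' - h ∈ K.comap H.subtype := by
          simpa using sub_mem hh' hh
        refine ⟨⟨h' - h, hmem⟩, Subtype.ext (Subtype.ext (Prod.ext rfl ?_))⟩
        simp [s]
    rw [← Nat.card_congr (Equiv.ofBijective s hs), Nat.card_eq_fintype_card,
      Module.card_eq_pow_finrank (K := F), hUk]
  rw [Nat.card_congr (Equiv.sigmaFiberEquiv g).symm, Nat.card_sigma,
    Finset.sum_congr rfl fun K _ => hfib K]
  rw [Finset.sum_const, Finset.card_univ, ← Nat.card_eq_fintype_card, Nat.card_coe_set_eq,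
    smul_eq_mul]

/-- A Cameron–Liebler `k`-set with total weight `x` has `x * [n k]_q` elements. -/
lemma ncard_eq_mul_sum (hφ : LinearMap.ker φ = H) (he : φ e = 1) {k : ℕ}
    {L : Set (Submodule F (Fin (n + 1) → F))} (hL : ∀ K ∈ L, IsAffSub k H K) [Fintype H]
    (f : H → ℝ) (hf : ∀ (U : Submodule F H) (h : H), finrank F U = k →
      Set.indicator L (fun _ => (1 : ℝ)) (flat e h U) = ∑ᶠ u : U, f (h + u)) :
    (L.ncard : ℝ) = Nat.card {U : Submodule F H // finrank F U = k} * ∑ h, f h := by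
  classical
  have hq : (Fintype.card F : ℝ) ^ k ≠ 0 := by positivity
  refine mul_right_cancel₀ hq ?_
  have h1 := congrArg (Nat.cast : ℕ → ℝ) (card_pairs_flat_mem hφ he hL)
  push_cast at h1
  rw [← h1, Nat.card_eq_fintype_card, Fintype.card_subtype, Finset.card_filter]
  push_cast
  rw [Fintype.sum_prod_type]
  have hU (U : {U : Submodule F H // finrank F U = k}) :
      ∑ h : H, (if flat e h U.1 ∈ L then 1 else 0 : ℝ) =
        Fintype.card F ^ k * ∑ h, f h := by
    have h2 (h : H) : (if flat e h U.1 ∈ L then 1 else 0 : ℝ) = ∑ u : U.1, f (h + u) := by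
      rw [← finsum_eq_sum_of_fintype, ← hf U.1 h U.2, Set.indicator_apply]
    rw [Finset.sum_congr rfl fun h _ => h2 h, Finset.sum_comm]
    have h3 (u : U.1) : ∑ h, f (h + u) = ∑ h, f h :=
      (AddGroup.addRight_bijective (u : H)).sum_comp f
    rw [Finset.sum_congr rfl fun u _ => h3 u, Finset.sum_const, Finset.card_univ,
      Module.card_eq_pow_finrank (K := F), U.2, nsmul_eq_mul]
    push_cast
    rfl
  rw [Finset.sum_congr rfl fun U _ => hU U, Finset.sum_const, Finset.card_univ,
    Nat.card_eq_fintype_card, nsmul_eq_mul]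
  ring

end AffineModel

theorem statement17 (q k : ℕ) (hq : IsPrimePow q) (hF : Fintype.card F = q)
    (hk : 1 ≤ k) (hn : k + 2 ≤ n)
    (Hinf : Submodule F (Fin (n + 1) → F)) (hH : Module.finrank F Hinf = n) :
    ¬ ∃ L : Set (Submodule F (Fin (n + 1) → F)),
      IsCLAff k Hinf L ∧ (L.ncard : ℚ) = 2 * gaussBinom q n k := by
  classical
  rintro ⟨L, ⟨hL, w, hw⟩, hcard⟩
  obtain ⟨φ, e, hφ, he⟩ : ∃ (φ : (Fin (n + 1) → F) →ₗ[F] F) (e : Fin (n + 1) → F),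
      LinearMap.ker φ = Hinf ∧ φ e = 1 := by
    have hlt : Hinf < ⊤ := lt_top_iff_ne_top.2 fun h => by
      rw [h, finrank_top, finrank_fin_fun] at hH
      omega
    obtain ⟨ψ, hψ, hle⟩ := Hinf.exists_le_ker_of_lt_top hlt
    obtain ⟨x, hx⟩ := DFunLike.ne_iff.1 hψ
    have hx0 : ψ x ≠ 0 := hx
    refine ⟨ψ, (ψ x)⁻¹ • x, (Submodule.eq_of_le_of_finrank_eq hle ?_).symm, by simp [hx0]⟩
    have h1 := ψ.finrank_range_add_finrank_ker
    rw [LinearMap.range_eq_top.2 (LinearMap.surjective hψ), finrank_top, finrank_self,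
      finrank_fin_fun] at h1
    omega
  set f : Hinf → ℝ := fun h => w (Submodule.span F {e + (h : Fin (n + 1) → F)}) with hfdef
  have hf (U : Submodule F Hinf) (h : Hinf) (hU : finrank F U = k) :
      Set.indicator L (fun _ => (1 : ℝ)) (flat e h U) = ∑ᶠ u : U, f (h + u) := by
    rw [hw _ ⟨by rw [finrank_flat hφ he, hU], flat_not_le hφ he h U⟩,
      finsum_affPoints_flat hφ he]
  refine sum_ne_two_of_flat_sums (F := F) hk (by omega) f (fun U h hU => ?_) ?_
  · rw [← hf U h hU, Set.indicator_apply]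
    split_ifs <;> simp
  · have hgr := card_grassmannian (F := F) (X := Hinf) (k := k) (by omega)
    rw [hF, hH] at hgr
    have h1 := ncard_eq_mul_sum hφ he hL f hf
    set G := Nat.card {U : Submodule F Hinf // finrank F U = k} with hG
    rw [← hgr] at hcard
    have hLG : (L.ncard : ℝ) = 2 * G := by exact_mod_cast hcard
    have hG0 : (G : ℝ) ≠ 0 := by
      obtain ⟨b, hb⟩ := exists_linearIndependent_of_le_finrank (R := F) (M := Hinf) (n := k)
        (by omega)
      have : Nonempty {U : Submodule F Hinf // finrank F U = k} :=
        ⟨⟨Submodule.span F (Set.range b), by simpa using finrank_span_eq_card hb⟩⟩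
      exact_mod_cast Nat.card_pos.ne'
    refine mul_left_cancel₀ hG0 ?_
    rw [← h1, hLG, mul_comm]
end

section
/- Let q be a prime power, F a finite field with q elements, k ≥ 1 and n ≥ k+2. If 𝓛 is a Cameron–Liebler k-set of AG(n,q) with |𝓛| = [n k]_q (parameter x = 1), then there exists an affine point P such that 𝓛 = {affine k-spaces K : P ≤ K}, the set of all affine k-spaces through P. -/
open Module

variable {F : Type} [Field F] [Fintype F] {n : ℕ}

set_option linter.unusedSectionVars false

section SubspaceCount

variable {E : Type*} [AddCommGroup E] [Module F E] [Finite E]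

/-- Choosing an ordered basis of each `k`-dimensional subspace counts the linearly independent
`k`-tuples. -/
theorem natCard_linearIndependent_eq_natCard_finrank_mul (k : ℕ) :
    Nat.card {s : Fin k → E // LinearIndependent F s} =
      Nat.card {D : Submodule F E // finrank F D = k} *
        ∏ i : Fin k, (Fintype.card F ^ k - Fintype.card F ^ (i : ℕ)) := by
  classical
  have : Fintype {D : Submodule F E // finrank F D = k} := Fintype.ofFinite _
  let e : (Σ D : {D : Submodule F E // finrank F D = k},
      {t : Fin k → D.1 // LinearIndependent F t}) → {s : Fin k → E // LinearIndependent F s} :=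
    fun x => ⟨fun i => (x.2.1 i : E), x.2.2.map' x.1.1.subtype x.1.1.ker_subtype⟩
  have span_eq : ∀ x, Submodule.span F (Set.range (e x).1) = x.1.1 := by
    rintro ⟨⟨D, hD⟩, t, ht⟩
    apply Submodule.eq_of_le_of_finrank_eq
    · rw [Submodule.span_le]
      rintro _ ⟨i, rfl⟩
      exact (t i).2
    · rw [finrank_span_eq_card (e _).2, Fintype.card_fin, hD]
  have he : Function.Bijective e := by
    constructor
    · intro x y hxy
      have h := span_eq x
      rw [hxy, span_eq y] at h
      obtain ⟨⟨D, hD⟩, t, ht⟩ := x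
      obtain ⟨⟨D', hD'⟩, t', ht'⟩ := y
      obtain rfl : D' = D := h
      have : t = t' := by
        funext i
        exact Subtype.ext (congrFun (congrArg Subtype.val hxy) i)
      subst this
      rfl
    · rintro ⟨s, hs⟩
      refine ⟨⟨⟨Submodule.span F (Set.range s), ?_⟩, fun i => ⟨s i, Submodule.subset_span ⟨i, rfl⟩⟩,
        ?_⟩, rfl⟩
      · rw [finrank_span_eq_card hs, Fintype.card_fin]
      · exact LinearIndependent.of_comp (Submodule.subtype _) hs
  rw [← Nat.card_congr (Equiv.ofBijective e he), Nat.card_sigma]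
  rw [Finset.sum_congr rfl (g := fun _ => ∏ i : Fin k,
    (Fintype.card F ^ k - Fintype.card F ^ (i : ℕ)))]
  · simp [Nat.card_eq_fintype_card]
  · rintro ⟨D, hD⟩ -
    rw [card_linearIndependent hD.ge, hD]

theorem gaussBinom_mul_prod {q m k : ℕ} (hq : 1 < q) (hk : k ≤ m) :
    gaussBinom q m k * ∏ i ∈ Finset.range k, ((q : ℚ) ^ k - (q : ℚ) ^ i) =
      ∏ i ∈ Finset.range k, ((q : ℚ) ^ m - (q : ℚ) ^ i) := by
  have factor : ∀ a, k ≤ a → ∏ i ∈ Finset.range k, ((q : ℚ) ^ a - (q : ℚ) ^ i) =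
      (∏ i ∈ Finset.range k, (q : ℚ) ^ i) * ∏ i ∈ Finset.range k, ((q : ℚ) ^ (a - i) - 1) := by
    intro a ha
    rw [← Finset.prod_mul_distrib]
    refine Finset.prod_congr rfl fun i hi => ?_
    rw [mul_sub, ← pow_add, mul_one, Nat.add_sub_cancel' ((Finset.mem_range.1 hi).le.trans ha)]
  have hrefl : ∏ i ∈ Finset.range k, ((q : ℚ) ^ (k - i) - 1) =
      ∏ i ∈ Finset.range k, ((q : ℚ) ^ (i + 1) - 1) := by
    rw [← Finset.prod_range_reflect]
    refine Finset.prod_congr rfl fun i hi => ?_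
    have := Finset.mem_range.1 hi
    rw [show k - (k - 1 - i) = i + 1 by omega]
  have hne : ∏ i ∈ Finset.range k, ((q : ℚ) ^ (i + 1) - 1) ≠ 0 := by
    refine Finset.prod_ne_zero_iff.2 fun i _ => ?_
    exact (sub_pos.2 (one_lt_pow₀ (by exact_mod_cast hq) i.succ_ne_zero)).ne'
  rw [factor k le_rfl, factor m hk, hrefl, gaussBinom, Finset.prod_div_distrib]
  field_simp

/-- The number of `k`-dimensional subspaces is a Gaussian binomial coefficient. -/
theorem natCard_finrank_eq_gaussBinom {k : ℕ} (hk : k ≤ finrank F E) :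
    (Nat.card {D : Submodule F E // finrank F D = k} : ℚ) =
      gaussBinom (Fintype.card F) (finrank F E) k := by
  have hq : 1 < Fintype.card F := Fintype.one_lt_card
  have cast_prod : ∀ a, k ≤ a →
      ((∏ i : Fin k, (Fintype.card F ^ a - Fintype.card F ^ (i : ℕ)) : ℕ) : ℚ) =
        ∏ i ∈ Finset.range k, ((Fintype.card F : ℚ) ^ a - (Fintype.card F : ℚ) ^ i) := by
    intro a ha
    rw [Finset.prod_range, Nat.cast_prod]
    refine Finset.prod_congr rfl fun i _ => ?_
    rw [Nat.cast_sub (Nat.pow_le_pow_right hq.le (i.2.le.trans ha))]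
    push_cast
    rfl
  have h := natCard_linearIndependent_eq_natCard_finrank_mul (F := F) (E := E) k
  rw [card_linearIndependent hk] at h
  have h' := congrArg (Nat.cast : ℕ → ℚ) h
  rw [Nat.cast_mul, cast_prod _ hk, cast_prod _ le_rfl, ← gaussBinom_mul_prod hq hk] at h'
  refine (mul_right_cancel₀ ?_ h').symm
  refine Finset.prod_ne_zero_iff.2 fun i hi => ?_
  exact (sub_pos.2 (pow_lt_pow_right₀ (by exact_mod_cast hq) (Finset.mem_range.1 hi))).ne'

theorem gaussBinom_pos {q m k : ℕ} (hq : 1 < q) (hk : k ≤ m) : 0 < gaussBinom q m k := by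
  have hq' : (1 : ℚ) < q := by exact_mod_cast hq
  refine Finset.prod_pos fun i hi => div_pos ?_ ?_
  · have := Finset.mem_range.1 hi
    exact sub_pos.2 (one_lt_pow₀ hq' (by omega))
  · exact sub_pos.2 (one_lt_pow₀ hq' i.succ_ne_zero)

end SubspaceCount

section CosetSum

variable {E : Type*} [AddCommGroup E] [Module F E] [Fintype E]

open Classical in
/-- The sum of `g` over the coset `u + D`. -/
noncomputable def cosetSum (g : E → ℝ) (D : Submodule F E) (u : E) : ℝ :=
  ∑ x with x - u ∈ D, g x

theorem cosetSum_congr (g : E → ℝ) {D : Submodule F E} {u v : E} (h : u - v ∈ D) :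
    cosetSum g D u = cosetSum g D v := by
  unfold cosetSum
  congr 1
  ext x
  simp only [Finset.mem_filter, Finset.mem_univ, true_and]
  rw [← D.add_mem_iff_left h, sub_add_sub_cancel]

open Classical in
theorem card_coset (D : Submodule F E) (x : E) :
    (Finset.univ.filter fun u => u - x ∈ D).card = Fintype.card F ^ finrank F D := by
  rw [← Module.card_eq_pow_finrank (K := F) (V := D), Fintype.card_subtype]
  refine Finset.card_nbij' (fun u => u - x) (fun u => u + x) ?_ ?_ ?_ ?_ <;> intro u <;> simp

open Classical in
/-- A set that is a union of cosets of `D` has the same total weight when measured by cosets,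
up to the factor `|D|`. -/
theorem sum_cosetSum (g : E → ℝ) (D : Submodule F E) (p : E → Prop)
    (hp : ∀ x u, x - u ∈ D → (p x ↔ p u)) :
    ∑ u with p u, cosetSum g D u = (Fintype.card F : ℝ) ^ finrank F D * ∑ x with p x, g x := by
  have key : ∀ x, (∑ u with p u, if x - u ∈ D then g x else 0) =
      if p x then (Fintype.card F : ℝ) ^ finrank F D * g x else 0 := by
    intro x
    rw [← Finset.sum_filter, Finset.filter_filter]
    by_cases hx : p x
    · rw [if_pos hx, Finset.sum_const, nsmul_eq_mul]
      congr 1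
      rw [← Nat.cast_pow, ← card_coset D x]
      congr 2
      ext u
      simp only [Finset.mem_filter, Finset.mem_univ, true_and]
      rw [← neg_sub u x, neg_mem_iff]
      exact ⟨And.right, fun h => ⟨(hp u x h).2 hx, h⟩⟩
    · rw [if_neg hx, Finset.filter_false_of_mem, Finset.sum_empty]
      rintro u - ⟨hu, hxu⟩
      exact hx ((hp x u hxu).2 hu)
  simp only [cosetSum, Finset.sum_filter (fun x => x - _ ∈ D)]
  rw [Finset.sum_comm, Finset.sum_congr rfl fun x _ => key x, ← Finset.sum_filter,
    Finset.mul_sum]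

variable {g : E → ℝ} {k : ℕ}

open Classical in
/-- The fibre of `φ` containing a coset of weight one has weight at least one. -/
theorem one_le_sum_fiber
    (hg : ∀ D : Submodule F E, finrank F D = k → ∀ u, cosetSum g D u = 0 ∨ cosetSum g D u = 1)
    {φ : Dual F E} {D : Submodule F E} (hD : finrank F D = k) (hφ : D ≤ LinearMap.ker φ)
    {s : E} (hs : cosetSum g D s = 1) : 1 ≤ ∑ x with φ x = φ s, g x := by
  have hcard : (0 : ℝ) < (Fintype.card F : ℝ) ^ finrank F D := by
    have := Fintype.card_pos (α := F)
    positivity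
  have hφ' : ∀ x u, x - u ∈ D → φ x = φ u := fun x u h => by
    have : φ (x - u) = 0 := hφ h
    rwa [map_sub, sub_eq_zero] at this
  have h := sum_cosetSum g D (fun x => φ x = φ s) fun x u hxu => by rw [hφ' x u hxu]
  refine le_of_mul_le_mul_left ?_ hcard
  rw [mul_one, ← h, ← Nat.cast_pow, ← card_coset D s, ← nsmul_one, ← Finset.sum_const]
  calc ∑ u with u - s ∈ D, (1 : ℝ) = ∑ u with u - s ∈ D, cosetSum g D u :=
        Finset.sum_congr rfl fun u hu => by
          rw [cosetSum_congr g (Finset.mem_filter.1 hu).2, hs]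
    _ ≤ ∑ u with φ u = φ s, cosetSum g D u := by
        refine Finset.sum_le_sum_of_subset_of_nonneg ?_ fun u _ _ => ?_
        · intro u hu
          simp only [Finset.mem_filter, Finset.mem_univ, true_and] at hu ⊢
          exact hφ' u s hu
        · rcases hg D hD u with h | h <;> simp [h]

open Classical in
theorem sum_fiber_nonneg
    (hg : ∀ D : Submodule F E, finrank F D = k → ∀ u, cosetSum g D u = 0 ∨ cosetSum g D u = 1)
    {φ : Dual F E} {D : Submodule F E} (hD : finrank F D = k) (hφ : D ≤ LinearMap.ker φ)
    (t : F) : 0 ≤ ∑ x with φ x = t, g x := by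
  have hcard : (0 : ℝ) < (Fintype.card F : ℝ) ^ finrank F D := by
    have := Fintype.card_pos (α := F)
    positivity
  have h := sum_cosetSum g D (fun x => φ x = t) fun x u hxu => by
    have : φ (x - u) = 0 := hφ hxu
    rw [map_sub, sub_eq_zero] at this
    rw [this]
  refine le_of_mul_le_mul_left ?_ hcard
  rw [mul_zero, ← h]
  refine Finset.sum_nonneg fun u _ => ?_
  rcases hg D hD u with h | h <;> simp [h]

/-- Cosets of weight one lie in the same fibre of `φ`, provided their directions lie in `ker φ`. -/
theorem apply_eq_apply_of_cosetSum_eq_one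
    (hg : ∀ D : Submodule F E, finrank F D = k → ∀ u, cosetSum g D u = 0 ∨ cosetSum g D u = 1)
    (htot : ∑ x, g x = 1) {φ : Dual F E} {D D' : Submodule F E}
    (hD : finrank F D = k) (hD' : finrank F D' = k)
    (hφ : D ≤ LinearMap.ker φ) (hφ' : D' ≤ LinearMap.ker φ) {s s' : E}
    (hs : cosetSum g D s = 1) (hs' : cosetSum g D' s' = 1) : φ s = φ s' := by
  classical
  by_contra hne
  have h1 := one_le_sum_fiber hg hD hφ hs
  have h2 := one_le_sum_fiber hg hD' hφ' hs'
  have h3 : ∑ t ∈ {φ s, φ s'}, ∑ x with φ x = t, g x ≤ ∑ t, ∑ x with φ x = t, g x :=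
    Finset.sum_le_sum_of_subset_of_nonneg (Finset.subset_univ _) fun t _ _ =>
      sum_fiber_nonneg hg hD hφ t
  have h4 : ∑ t, ∑ x with φ x = t, g x = ∑ x, g x := Finset.sum_fiberwise _ _ _
  rw [Finset.sum_pair hne, h4, htot] at h3
  linarith

theorem exists_cosetSum_eq_one
    (hg : ∀ D : Submodule F E, finrank F D = k → ∀ u, cosetSum g D u = 0 ∨ cosetSum g D u = 1)
    (htot : ∑ x, g x = 1) {D : Submodule F E} (hD : finrank F D = k) :
    ∃ s, cosetSum g D s = 1 := by
  by_contra! h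
  have h0 : ∀ u, cosetSum g D u = 0 := fun u => (hg D hD u).resolve_right (h u)
  have := sum_cosetSum g D (fun _ => True) (by simp)
  simp only [h0, htot, Finset.filter_true, Finset.sum_const_zero, mul_one] at this
  have hcard := Fintype.card_pos (α := F)
  exact (pow_pos (Nat.cast_pos.2 hcard) (finrank F D)).ne this

theorem exists_le_finrank_eq {W : Submodule F E} (hk : k ≤ finrank F W) :
    ∃ D ≤ W, finrank F D = k := by
  obtain ⟨s, hs⟩ := exists_linearIndependent_of_le_finrank hk
  have hs' := hs.map' W.subtype W.ker_subtype
  refine ⟨Submodule.span F (Set.range (W.subtype ∘ s)), ?_, ?_⟩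
  · rw [Submodule.span_le]
    rintro _ ⟨i, rfl⟩
    exact (s i).2
  · rw [finrank_span_eq_card hs', Fintype.card_fin]

theorem le_finrank_ker_inf_ker (hk : k + 2 ≤ finrank F E) (φ ψ : Dual F E) :
    k ≤ finrank F (LinearMap.ker φ ⊓ LinearMap.ker ψ : Submodule F E) := by
  rw [← LinearMap.ker_prod]
  have h := (φ.prod ψ).finrank_range_add_finrank_ker
  have h' := Submodule.finrank_le (LinearMap.range (φ.prod ψ))
  rw [finrank_prod, finrank_self] at h'
  omega

/-- A function of total weight one whose sum over each coset of each `k`-dimensional subspace is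
`0` or `1` has coset sums of a point mass. -/
theorem exists_point_of_cosetSum (hk : k + 2 ≤ finrank F E)
    (hg : ∀ D : Submodule F E, finrank F D = k → ∀ u, cosetSum g D u = 0 ∨ cosetSum g D u = 1)
    (htot : ∑ x, g x = 1) :
    ∃ p, ∀ D : Submodule F E, finrank F D = k → ∀ u, cosetSum g D u = 1 ↔ p - u ∈ D := by
  have hc : ∀ φ : Dual F E, ∃ c : F, ∀ D : Submodule F E, finrank F D = k →
      D ≤ LinearMap.ker φ → ∀ s, cosetSum g D s = 1 → φ s = c := by
    intro φ
    obtain ⟨D, hle, hD⟩ := exists_le_finrank_eq (le_finrank_ker_inf_ker hk φ φ)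
    obtain ⟨s, hs⟩ := exists_cosetSum_eq_one hg htot hD
    exact ⟨φ s, fun D' hD' hle' s' hs' => apply_eq_apply_of_cosetSum_eq_one hg htot hD' hD hle'
      (hle.trans inf_le_left) hs' hs⟩
  choose c hc using hc
  let C : Dual F (Dual F E) :=
    { toFun := c
      map_add' := by
        intro φ ψ
        obtain ⟨D, hle, hD⟩ := exists_le_finrank_eq (le_finrank_ker_inf_ker hk φ ψ)
        obtain ⟨s, hs⟩ := exists_cosetSum_eq_one hg htot hD
        have hφ := hle.trans inf_le_left
        have hψ := hle.trans inf_le_right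
        have hadd : D ≤ LinearMap.ker (φ + ψ) := fun x hx => by
          have h1 : φ x = 0 := hφ hx
          have h2 : ψ x = 0 := hψ hx
          simp [h1, h2]
        rw [← hc φ D hD hφ s hs, ← hc ψ D hD hψ s hs, ← hc _ D hD hadd s hs,
          LinearMap.add_apply]
      map_smul' := by
        intro a φ
        obtain ⟨D, hle, hD⟩ := exists_le_finrank_eq (le_finrank_ker_inf_ker hk φ φ)
        obtain ⟨s, hs⟩ := exists_cosetSum_eq_one hg htot hD
        have hφ := hle.trans inf_le_left
        have hsmul : D ≤ LinearMap.ker (a • φ) := fun x hx => by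
          have h1 : φ x = 0 := hφ hx
          simp [h1]
        rw [← hc φ D hD hφ s hs, ← hc _ D hD hsmul s hs, LinearMap.smul_apply, RingHom.id_apply] }
  obtain ⟨p, hp⟩ := (Module.evalEquiv F E).surjective C
  have hpc : ∀ φ : Dual F E, φ p = c φ := fun φ => LinearMap.congr_fun hp φ
  have hmem : ∀ D : Submodule F E, finrank F D = k → ∀ u, cosetSum g D u = 1 → p - u ∈ D := by
    intro D hD u hu
    rw [← Subspace.forall_mem_dualAnnihilator_apply_eq_zero_iff D]
    intro φ hφ
    rw [Submodule.mem_dualAnnihilator] at hφ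
    rw [map_sub, hpc, hc φ D hD hφ u hu, sub_self]
  refine ⟨p, fun D hD u => ⟨hmem D hD u, fun hu => ?_⟩⟩
  obtain ⟨s, hs⟩ := exists_cosetSum_eq_one hg htot hD
  rw [← hs]
  refine (cosetSum_congr g ?_).symm
  simpa using sub_mem hu (hmem D hD s hs)

end CosetSum

section AffineSpan

variable {V : Type*} [AddCommGroup V] [Module F V]

/-- The linear span of the affine subspace `e + u + D`, where the direction `D` lies in `H`. -/
def affSpan {H : Submodule F V} (e : V) (D : Submodule F H) (u : H) : Submodule F V :=
  D.map H.subtype ⊔ F ∙ (e + u)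

variable {h : V →ₗ[F] F} {H : Submodule F V} {e : V}

theorem add_mem_affSpan_iff (hH : ∀ v, v ∈ H ↔ h v = 0) (he : h e = 1)
    {D : Submodule F H} {u x : H} : e + x ∈ affSpan e D u ↔ x - u ∈ D := by
  have hu : h u = 0 := (hH u).1 u.2
  have hx : h x = 0 := (hH x).1 x.2
  constructor
  · intro hmem
    obtain ⟨_, ⟨d, hd, rfl⟩, _, ha, heq⟩ := Submodule.mem_sup.1 hmem
    obtain ⟨a, rfl⟩ := Submodule.mem_span_singleton.1 ha
    have hd0 : h d = 0 := (hH d).1 d.2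
    have ha1 : a = 1 := by simpa [hd0, he, hu, hx] using congrArg h heq
    have : x - u = d := by
      apply Subtype.ext
      rw [ha1, one_smul] at heq
      have heq' : (d : V) + (e + u) = e + x := heq
      push_cast
      rw [sub_eq_iff_eq_add]
      apply add_left_cancel (a := e)
      rw [← heq']
      abel
    rwa [this]
  · intro hmem
    refine Submodule.mem_sup.2 ⟨_, ⟨x - u, hmem, rfl⟩, e + u, Submodule.mem_span_singleton_self _, ?_⟩
    simp only [Submodule.subtype_apply, AddSubgroupClass.coe_sub]
    abel

theorem affSpan_not_le (hH : ∀ v, v ∈ H ↔ h v = 0) (he : h e = 1)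
    (D : Submodule F H) (u : H) : ¬ affSpan e D u ≤ H := by
  intro hle
  have h1 := (hH _).1 (hle ((add_mem_affSpan_iff hH he (D := D) (u := u) (x := u)).2 (by simp)))
  have hu : h u = 0 := (hH u).1 u.2
  simp [he, hu] at h1

theorem comap_affSpan (hH : ∀ v, v ∈ H ↔ h v = 0) (he : h e = 1)
    (D : Submodule F H) (u : H) : (affSpan e D u).comap H.subtype = D := by
  ext x
  rw [Submodule.mem_comap, Submodule.subtype_apply]
  have hself : e + u ∈ affSpan e D u := (add_mem_affSpan_iff hH he).2 (by simp)
  rw [← Submodule.add_mem_iff_right _ hself, add_assoc, ← Submodule.coe_add,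
    add_mem_affSpan_iff hH he, add_sub_cancel_left]

theorem finrank_affSpan [FiniteDimensional F V] (hH : ∀ v, v ∈ H ↔ h v = 0) (he : h e = 1)
    (D : Submodule F H) (u : H) : finrank F (affSpan e D u) = finrank F D + 1 := by
  have hu : h u = 0 := (hH u).1 u.2
  have hne : e + (u : V) ≠ 0 := fun h0 => by simpa [he, hu] using congrArg h h0
  have hdisj : D.map H.subtype ⊓ F ∙ (e + (u : V)) = ⊥ := by
    rw [eq_bot_iff]
    rintro _ ⟨⟨d, -, rfl⟩, ha⟩
    obtain ⟨a, ha⟩ := Submodule.mem_span_singleton.1 ha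
    have hd0 : h d = 0 := (hH d).1 d.2
    have : a = 0 := by simpa [he, hu, hd0] using congrArg h ha
    rw [← ha, this, zero_smul]
    exact Submodule.zero_mem _
  have hsum := Submodule.finrank_sup_add_finrank_inf_eq (D.map H.subtype) (F ∙ (e + (u : V)))
  rwa [hdisj, finrank_bot, add_zero, finrank_span_singleton hne,
    LinearEquiv.finrank_eq (Submodule.equivMapOfInjective _ H.injective_subtype D).symm] at hsum

theorem exists_add_mem_of_not_le (hH : ∀ v, v ∈ H ↔ h v = 0) (he : h e = 1)
    {K : Submodule F V} (hK : ¬ K ≤ H) : ∃ u : H, e + u ∈ K := by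
  obtain ⟨v, hv, hvH⟩ := SetLike.not_le_iff_exists.1 hK
  rw [hH] at hvH
  refine ⟨⟨(h v)⁻¹ • v - e, (hH _).2 ?_⟩, ?_⟩
  · simp [he, hvH]
  · simpa using K.smul_mem _ hv

theorem affSpan_comap_eq (hH : ∀ v, v ∈ H ↔ h v = 0) (he : h e = 1)
    {K : Submodule F V} {u : H} (hu : e + u ∈ K) : affSpan e (K.comap H.subtype) u = K := by
  apply le_antisymm
  · refine sup_le (Submodule.map_comap_le _ _) ?_
    rwa [Submodule.span_singleton_le_iff_mem]
  · intro v hv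
    have hu0 : h u = 0 := (hH u).1 u.2
    refine Submodule.mem_sup.2 ⟨v - h v • (e + u), ⟨⟨v - h v • (e + u), (hH _).2 ?_⟩, ?_, rfl⟩,
      h v • (e + u), Submodule.smul_mem _ _ (Submodule.mem_span_singleton_self _),
      sub_add_cancel _ _⟩
    · simp [he, hu0]
    · exact K.sub_mem hv (K.smul_mem _ hu)

theorem affSpan_eq_affSpan_iff (hH : ∀ v, v ∈ H ↔ h v = 0) (he : h e = 1)
    {D D' : Submodule F H} {u u' : H} :
    affSpan e D u = affSpan e D' u' ↔ D = D' ∧ u - u' ∈ D' := by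
  constructor
  · intro heq
    have hD : D = D' := by rw [← comap_affSpan hH he D u, heq, comap_affSpan hH he]
    refine ⟨hD, ?_⟩
    rw [← add_mem_affSpan_iff hH he, ← heq, add_mem_affSpan_iff hH he, sub_self]
    exact D.zero_mem
  · rintro ⟨rfl, hu⟩
    rw [← add_mem_affSpan_iff hH he] at hu
    have := affSpan_comap_eq hH he hu
    rwa [comap_affSpan hH he] at this

end AffineSpan

theorem exists_linearMap_of_finrank_eq {H : Submodule F (Fin (n + 1) → F)} (hH : finrank F H = n) :
    ∃ (h : (Fin (n + 1) → F) →ₗ[F] F) (e : Fin (n + 1) → F),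
      (∀ v, v ∈ H ↔ h v = 0) ∧ h e = 1 := by
  have hne : H < ⊤ := by
    rw [lt_top_iff_ne_top]
    rintro rfl
    simp at hH
  obtain ⟨e, -, he⟩ := SetLike.exists_of_lt hne
  obtain ⟨h, hhe, hle⟩ := Submodule.exists_le_ker_of_notMem he
  have hker : H = LinearMap.ker h := by
    apply Submodule.eq_of_le_of_finrank_le hle
    have h1 := h.finrank_range_add_finrank_ker
    rw [LinearMap.range_eq_top.2 (LinearMap.surjective fun h0 => hhe (by simp [h0])), finrank_top,
      finrank_self, finrank_fin_fun] at h1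
    omega
  refine ⟨h, (h e)⁻¹ • e, fun v => by rw [hker, LinearMap.mem_ker], by simp [hhe]⟩

section Weight

variable {h : (Fin (n + 1) → F) →ₗ[F] F} {H : Submodule F (Fin (n + 1) → F)} {e : Fin (n + 1) → F}

theorem isAffPoint_span (hH : ∀ v, v ∈ H ↔ h v = 0) (he : h e = 1) (x : H) :
    IsAffPoint H (F ∙ (e + x : Fin (n + 1) → F)) := by
  have hx : h x = 0 := (hH x).1 x.2
  refine ⟨finrank_span_singleton fun h0 => by simpa [he, hx] using congrArg h h0, ?_⟩
  rw [Submodule.span_singleton_le_iff_mem, hH]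
  simp [he, hx]

theorem IsAffPoint.exists_eq_span (hH : ∀ v, v ∈ H ↔ h v = 0) (he : h e = 1)
    {P : Submodule F (Fin (n + 1) → F)} (hP : IsAffPoint H P) :
    ∃ x : H, P = F ∙ (e + x : Fin (n + 1) → F) := by
  obtain ⟨x, hx⟩ := exists_add_mem_of_not_le hH he hP.2
  refine ⟨x, (Submodule.eq_of_le_of_finrank_eq ?_ ?_).symm⟩
  · rwa [Submodule.span_singleton_le_iff_mem]
  · rw [hP.1, (isAffPoint_span hH he x).1]

theorem finsum_affPoint_eq_cosetSum [Fintype H] (hH : ∀ v, v ∈ H ↔ h v = 0) (he : h e = 1)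
    (w : Submodule F (Fin (n + 1) → F) → ℝ) (D : Submodule F H) (u : H) :
    ∑ᶠ P ∈ {P | IsAffPoint H P ∧ P ≤ affSpan e D u}, w P =
      cosetSum (fun x : H => w (F ∙ (e + x : Fin (n + 1) → F))) D u := by
  classical
  rw [cosetSum, ← finsum_mem_coe_finset]
  symm
  refine finsum_mem_eq_of_bijOn (fun x : H => F ∙ (e + x : Fin (n + 1) → F)) ⟨?_, ?_, ?_⟩
    fun _ _ => rfl
  · intro x hx
    refine ⟨isAffPoint_span hH he x, ?_⟩
    rw [Submodule.span_singleton_le_iff_mem, add_mem_affSpan_iff hH he]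
    simpa using hx
  · intro x _ y _ hxy
    have hx : h x = 0 := (hH x).1 x.2
    have hy : h y = 0 := (hH y).1 y.2
    have hmem : e + (x : Fin (n + 1) → F) ∈ F ∙ (e + y : Fin (n + 1) → F) :=
      (show F ∙ (e + x : Fin (n + 1) → F) = F ∙ (e + y : Fin (n + 1) → F) from hxy) ▸
        Submodule.mem_span_singleton_self _
    obtain ⟨a, ha⟩ := Submodule.mem_span_singleton.1 hmem
    have ha1 : a = 1 := by simpa [he, hx, hy] using congrArg h ha
    rw [ha1, one_smul] at ha
    exact Subtype.ext (add_left_cancel ha).symm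
  · rintro P ⟨hP, hPK⟩
    obtain ⟨x, rfl⟩ := hP.exists_eq_span hH he
    rw [Submodule.span_singleton_le_iff_mem, add_mem_affSpan_iff hH he] at hPK
    exact ⟨x, by simpa using hPK, rfl⟩

theorem IsAffSub.exists_eq_affSpan {k : ℕ} (hH : ∀ v, v ∈ H ↔ h v = 0) (he : h e = 1)
    {K : Submodule F (Fin (n + 1) → F)} (hK : IsAffSub k H K) :
    ∃ (D : Submodule F H) (u : H), finrank F D = k ∧ K = affSpan e D u := by
  obtain ⟨u, hu⟩ := exists_add_mem_of_not_le hH he hK.2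
  have hKu := affSpan_comap_eq hH he hu
  refine ⟨K.comap H.subtype, u, ?_, hKu.symm⟩
  have := finrank_affSpan hH he (K.comap H.subtype) u
  rw [hKu, hK.1] at this
  omega

open Classical in
/-- Each affine `k`-space `e + u + D` is counted once for each of its `|D|` representatives `u`. -/
theorem sum_card_affSpan_mem [Fintype H] [Fintype (Submodule F H)] {k : ℕ}
    (hH : ∀ v, v ∈ H ↔ h v = 0) (he : h e = 1)
    {L : Set (Submodule F (Fin (n + 1) → F))} (hL : ∀ K ∈ L, IsAffSub k H K) :
    ∑ D ∈ Finset.univ.filter (fun D : Submodule F H => finrank F D = k),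
        (Finset.univ.filter fun u => affSpan e D u ∈ L).card =
      L.ncard * Fintype.card F ^ k := by
  have : Fintype (Submodule F (Fin (n + 1) → F)) := Fintype.ofFinite _
  have hmaps : ∀ x ∈ (Finset.univ.filter fun D : Submodule F H => finrank F D = k).sigma
      (fun D => Finset.univ.filter fun u => affSpan e D u ∈ L),
      affSpan e x.1 x.2 ∈ L.toFinset := by
    intro x hx
    simp only [Finset.mem_sigma, Finset.mem_filter, Finset.mem_univ, true_and] at hx
    simpa using hx.2
  rw [← Finset.card_sigma, Finset.card_eq_sum_card_fiberwise hmaps, Set.ncard_eq_toFinset_card',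
    ← smul_eq_mul, ← Finset.sum_const]
  refine Finset.sum_congr rfl fun K hK => ?_
  rw [Set.mem_toFinset] at hK
  obtain ⟨D, u, hD, rfl⟩ := (hL K hK).exists_eq_affSpan hH he
  rw [← hD, ← card_coset D u]
  symm
  refine Finset.card_nbij (fun v => ⟨D, v⟩) ?_ ?_ ?_
  · intro v hv
    have hv' : affSpan e D v = affSpan e D u :=
      (affSpan_eq_affSpan_iff hH he).2 ⟨rfl, by simpa using hv⟩
    simp [hv', hK]
  · intro v _ v' _ hvv
    simpa using hvv
  · rintro ⟨D', v⟩ hx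
    simp only [Finset.coe_filter, Finset.mem_sigma, Finset.mem_filter, Finset.mem_univ, true_and,
      Set.mem_ofPred_eq] at hx
    obtain ⟨rfl, hv⟩ := (affSpan_eq_affSpan_iff hH he).1 hx.2
    exact ⟨v, by simpa using hv, rfl⟩

end Weight

theorem statement18 (q k : ℕ) (hq : IsPrimePow q) (hF : Fintype.card F = q)
    (hk : 1 ≤ k) (hn : k + 2 ≤ n)
    (Hinf : Submodule F (Fin (n + 1) → F)) (hH : Module.finrank F Hinf = n)
    (L : Set (Submodule F (Fin (n + 1) → F)))
    (hL : IsCLAff k Hinf L)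
    (hcard : (L.ncard : ℚ) = gaussBinom q n k) :
    ∃ P, IsAffPoint Hinf P ∧ L = {K | IsAffSub k Hinf K ∧ P ≤ K} := by
  classical
  subst hF
  obtain ⟨hLsub, w, hw⟩ := hL
  obtain ⟨h, e, hmem, he⟩ := exists_linearMap_of_finrank_eq hH
  have : Fintype Hinf := Fintype.ofFinite _
  have : Fintype (Submodule F Hinf) := Fintype.ofFinite _
  set g : Hinf → ℝ := fun x => w (F ∙ (e + x : Fin (n + 1) → F)) with hgdef
  have hsub : ∀ D : Submodule F Hinf, finrank F D = k → ∀ u, IsAffSub k Hinf (affSpan e D u) :=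
    fun D hD u => ⟨by rw [finrank_affSpan hmem he, hD], affSpan_not_le hmem he D u⟩
  have hsum : ∀ D : Submodule F Hinf, finrank F D = k → ∀ u,
      cosetSum g D u = if affSpan e D u ∈ L then 1 else 0 := by
    intro D hD u
    rw [← finsum_affPoint_eq_cosetSum hmem he, ← hw _ (hsub D hD u), Set.indicator_apply]
  have hg : ∀ D : Submodule F Hinf, finrank F D = k → ∀ u,
      cosetSum g D u = 0 ∨ cosetSum g D u = 1 := by
    intro D hD u
    rw [hsum D hD u]
    split_ifs <;> simp
  have htot : ∑ x, g x = 1 := by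
    have hcardF : ((Fintype.card F : ℝ) ^ k) ≠ 0 := by
      have := Fintype.card_pos (α := F)
      positivity
    have hdir : ∀ D : Submodule F Hinf, finrank F D = k →
        ((Finset.univ.filter fun u => affSpan e D u ∈ L).card : ℝ) =
          (Fintype.card F : ℝ) ^ k * ∑ x, g x := by
      intro D hD
      have := sum_cosetSum g D (fun _ => True) (by simp)
      simp only [Finset.filter_true, hD, hsum D hD] at this
      rw [← this, Finset.sum_boole]
    have hcount := congrArg (Nat.cast : ℕ → ℝ) (sum_card_affSpan_mem hmem he hLsub)
    have hnum : (L.ncard : ℚ) = (Nat.card {D : Submodule F Hinf // finrank F D = k} : ℚ) := by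
      rw [hcard, natCard_finrank_eq_gaussBinom (by omega), hH]
    have hpos : (0 : ℚ) < L.ncard := by
      rw [hcard]
      exact gaussBinom_pos Fintype.one_lt_card (by omega)
    have hnum' : L.ncard = (Finset.univ.filter fun D : Submodule F Hinf => finrank F D = k).card := by
      rw [← Fintype.card_subtype, ← Nat.card_eq_fintype_card]
      exact_mod_cast hnum
    rw [Nat.cast_sum, Finset.sum_congr rfl fun D hD => hdir D (Finset.mem_filter.1 hD).2,
      Finset.sum_const, ← hnum', nsmul_eq_mul, Nat.cast_mul, Nat.cast_pow] at hcount
    have hne : (L.ncard : ℝ) ≠ 0 := by exact_mod_cast hpos.ne'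
    exact mul_left_cancel₀ hcardF (by rw [mul_left_cancel₀ hne hcount, mul_one])
  obtain ⟨p, hp⟩ := exists_point_of_cosetSum (by omega) hg htot
  have hmemL : ∀ D : Submodule F Hinf, finrank F D = k → ∀ u,
      affSpan e D u ∈ L ↔ F ∙ (e + p : Fin (n + 1) → F) ≤ affSpan e D u := by
    intro D hD u
    rw [Submodule.span_singleton_le_iff_mem, add_mem_affSpan_iff hmem he, ← hp D hD u, hsum D hD u]
    simp
  refine ⟨F ∙ (e + p : Fin (n + 1) → F), isAffPoint_span hmem he p, ?_⟩
  ext K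
  constructor
  · intro hK
    obtain ⟨D, u, hD, rfl⟩ := (hLsub K hK).exists_eq_affSpan hmem he
    exact ⟨hLsub _ hK, (hmemL D hD u).1 hK⟩
  · rintro ⟨hK, hPK⟩
    obtain ⟨D, u, hD, rfl⟩ := hK.exists_eq_affSpan hmem he
    exact (hmemL D hD u).2 hPK
end

section
/- Let q be a prime power, F a finite field with q elements, and n ≥ 2. For every (n−1)-spread S of AG(n,q) there exists a submodule W ≤ H∞ with finrank W = n−1 (an (n−2)-space at infinity) such that S = {affine (n−1)-spaces K : W ≤ K}; that is, every (n−1)-spread of AG(n,q) consists of all affine hyperplanes through a fixed (n−2)-space at infinity (a spread of type II). -/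
open Module

variable {F : Type} [Field F] [Fintype F] {n : ℕ}

omit [Fintype F] in
theorem isAffPoint_span_singleton {Hinf : Submodule F (Fin (n + 1) → F)} {v : Fin (n + 1) → F}
    (hv : v ∉ Hinf) : IsAffPoint Hinf (Submodule.span F {v}) := by
  refine ⟨finrank_span_singleton fun h => hv (h ▸ Hinf.zero_mem), fun h => hv ?_⟩
  exact h (Submodule.mem_span_singleton_self v)

omit [Fintype F] in
theorem finrank_inf_ge {A B : Submodule F (Fin (n + 1) → F)}
    (hA : finrank F A = n) (hB : finrank F B = n) : n - 1 ≤ finrank F ↥(A ⊓ B) := by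
  have h := Submodule.finrank_sup_add_finrank_inf_eq A B
  have h' := Submodule.finrank_le (A ⊔ B)
  rw [Module.finrank_fin_fun] at h'
  omega

omit [Fintype F] in
theorem finrank_inf_lt {A B : Submodule F (Fin (n + 1) → F)}
    (hA : finrank F A = n) (h : ¬ A ≤ B) : finrank F ↥(A ⊓ B) < n :=
  (Submodule.finrank_lt_finrank_of_lt (inf_lt_left.mpr h)).trans_eq hA

omit [Fintype F] in
/-- Two hyperplanes whose intersection lies in a third one, which contains neither of them,
meet that one in the same subspace. -/
theorem inf_eq_inf_of_inf_le {A B H : Submodule F (Fin (n + 1) → F)}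
    (hA : finrank F A = n) (hB : finrank F B = n) (hAH : ¬ A ≤ H) (hBH : ¬ B ≤ H)
    (h : A ⊓ B ≤ H) : A ⊓ H = B ⊓ H := by
  have hge := finrank_inf_ge hA hB
  have hltA := finrank_inf_lt hA hAH
  have hltB := finrank_inf_lt hB hBH
  have eA : A ⊓ B = A ⊓ H :=
    Submodule.eq_of_le_of_finrank_le (le_inf inf_le_left h) (by omega)
  have eB : A ⊓ B = B ⊓ H :=
    Submodule.eq_of_le_of_finrank_le (le_inf inf_le_right h) (by omega)
  exact eA.symm.trans eB

omit [Fintype F] in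
/-- Two hyperplanes through `W` of codimension two that share a vector outside `H ⊇ W` agree. -/
theorem eq_of_le_of_mem {A B H W : Submodule F (Fin (n + 1) → F)}
    (hA : finrank F A = n) (hB : finrank F B = n) (hW : finrank F W = n - 1) (hWH : W ≤ H)
    (hWA : W ≤ A) (hWB : W ≤ B) {v : Fin (n + 1) → F} (hvH : v ∉ H) (hvA : v ∈ A)
    (hvB : v ∈ B) : A = B := by
  have hlt : W < A ⊓ B :=
    lt_of_le_of_ne (le_inf hWA hWB) fun h => hvH (hWH (h ▸ ⟨hvA, hvB⟩))
  have hr := Submodule.finrank_lt_finrank_of_lt hlt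
  have eA : A ⊓ B = A := Submodule.eq_of_le_of_finrank_le inf_le_left (by omega)
  have eB : A ⊓ B = B := Submodule.eq_of_le_of_finrank_le inf_le_right (by omega)
  exact eA.symm.trans eB

theorem statement19 (q : ℕ) (hq : IsPrimePow q) (hF : Fintype.card F = q)
    (hn : 2 ≤ n)
    (Hinf : Submodule F (Fin (n + 1) → F)) (hH : Module.finrank F Hinf = n)
    (S : Set (Submodule F (Fin (n + 1) → F)))
    (hS : IsSpread (n - 1) Hinf S) :
    ∃ W : Submodule F (Fin (n + 1) → F), W ≤ Hinf ∧
      Module.finrank F W = n - 1 ∧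
      S = {K | IsAffSub (n - 1) Hinf K ∧ W ≤ K} := by
  have hrank {K : Submodule F (Fin (n + 1) → F)} (hK : IsAffSub (n - 1) Hinf K) :
      finrank F K = n := by
    have := hK.1
    omega
  have hcover {v : Fin (n + 1) → F} (hv : v ∉ Hinf) : ∃ K ∈ S, v ∈ K := by
    obtain ⟨K, ⟨hKS, hK⟩, -⟩ := hS.2 _ (isAffPoint_span_singleton hv)
    exact ⟨K, hKS, hK (Submodule.mem_span_singleton_self v)⟩
  have hmeet {A B : Submodule F (Fin (n + 1) → F)} (hA : A ∈ S) (hB : B ∈ S) :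
      A ⊓ Hinf = B ⊓ Hinf := by
    by_cases hAB : A = B
    · rw [hAB]
    have hA' := hS.1 A hA
    have hB' := hS.1 B hB
    refine inf_eq_inf_of_inf_le (hrank hA') (hrank hB') hA'.2 hB'.2 fun v hv => ?_
    by_contra hvH
    exact hAB ((hS.2 _ (isAffPoint_span_singleton hvH)).unique
      ⟨hA, (Submodule.span_singleton_le_iff_mem _ _).mpr hv.1⟩
      ⟨hB, (Submodule.span_singleton_le_iff_mem _ _).mpr hv.2⟩)
  obtain ⟨v₀, -, hv₀⟩ : ∃ v ∈ (⊤ : Submodule F (Fin (n + 1) → F)), v ∉ Hinf := by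
    refine SetLike.not_le_iff_exists.mp fun h => ?_
    have := Submodule.finrank_mono h
    rw [finrank_top, Module.finrank_fin_fun] at this
    omega
  obtain ⟨K₀, hK₀, -⟩ := hcover hv₀
  have hK₀' := hS.1 K₀ hK₀
  have hW : finrank F ↥(K₀ ⊓ Hinf) = n - 1 := by
    have := finrank_inf_lt (hrank hK₀') hK₀'.2
    have := finrank_inf_ge (hrank hK₀') hH
    omega
  refine ⟨K₀ ⊓ Hinf, inf_le_right, hW, Set.ext fun K => ⟨fun hK => ?_, ?_⟩⟩
  · exact ⟨hS.1 K hK, hmeet hK₀ hK ▸ inf_le_left⟩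
  · rintro ⟨hK, hWK⟩
    obtain ⟨v, hvK, hvH⟩ := SetLike.not_le_iff_exists.mp hK.2
    obtain ⟨K', hK', hvK'⟩ := hcover hvH
    rwa [eq_of_le_of_mem (hrank hK) (hrank (hS.1 K' hK')) hW inf_le_right hWK
      (hmeet hK₀ hK' ▸ inf_le_left) hvH hvK hvK']
end
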